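/- arXiv:2006.16330 — 2 statements merged into one kernel-verified Lean document; each statement's English description precedes it below -/
import Mathlib

section
/- Let 𝔊_TY = (B, Δ, S, ε) be the Tambara–Yamagami weak Hopf *-algebra attached to (G, χ, τ), and for x ∈ Subgrp(G) ⊔ {Ω} let I^x be the invariant coideals defined by I^L := span{ v^0_Y : Y ∈ G/L } ⊗ conj(H^0) + Σ_{l∈L^⊥} ℂ v^l_m ⊗ conj(H^l) for subgroups L ≤ G and I^Ω := B_s. Extend the lattice Subgrp(G) to Subgrp(G) ⊔ {Ω} by L ∧ Ω := L and L ∨ Ω := Ω. Then the map x ↦ I^x is an anti-isomorphism of lattices onto the lattice of invariant coideals of 𝔊_TY (with I ∧ I' = I ∩ I' and I ∨ I' the *-subalgebra generated by I ∪ I'); in particular, for all subgroups L, K ≤ G: I^{L+K} = I^L ∩ I^K, and I^{L∩K} equals the *-subalgebra generated by I^L ∪ I^K. -/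
open scoped TensorProduct

noncomputable section

open scoped Classical

section TY

variable (G : Type) [AddCommGroup G] [Fintype G] [DecidableEq G]

/-- The index set `Ω = G ⊔ {m}` of the set of simple objects. -/
abbrev ΩIdx := G ⊕ Unit

/-- The index set `G ⊔ Ḡ` of the basis of `H^m`. -/
abbrev MIdx := G ⊕ G

/-- The basis index set of `V = ⊕_{x ∈ Ω} H^x`: `inl (g, y)` is `v^g_y` (`y ∈ Ω`),
`inr (inl k)` is `v^m_k` and `inr (inr k)` is `v^m_{k̄}`. -/
abbrev VIdx := (G × ΩIdx G) ⊕ MIdx G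

/-- The tyGrade (`∈ Ω`) of a basis vector of `V`. -/
def tyGrade : VIdx G → ΩIdx G
  | Sum.inl (g, _) => Sum.inl g
  | Sum.inr _ => Sum.inr ()

/-- `V = ⊕_{x ∈ Ω} H^x`, as coordinate functions. -/
abbrev TYV := VIdx G → ℂ

/-- Basis index set of `B = ⊕_{x ∈ Ω} H^x ⊗ conj(H^x)`: pairs of equal tyGrade;
the pair `(α, β)` of tyGrade `x` encodes `f^x_{α,β} = v^x_α ⊗ conj (v^x_β)`. -/
abbrev BIdx := {p : VIdx G × VIdx G // tyGrade G p.1 = tyGrade G p.2}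

/-- The underlying space of the Tambara–Yamagami weak Hopf `*`-algebra. -/
abbrev TYB := BIdx G → ℂ

/-- Structure constants of the multiplication `∘` on `V`:
`circC χ τ a b c` is the coefficient of the basis vector `c` in `(basis a) ∘ (basis b)`. -/
def circC (χ : G → G → ℂ) (τ : ℝ) : VIdx G → VIdx G → VIdx G → ℂ
  | Sum.inl (g, Sum.inl k), Sum.inl (h, x), r =>
      if x = Sum.inl (h + k) ∧ r = Sum.inl (g + h, Sum.inl (h + k)) then 1 else 0
  | Sum.inl (g, Sum.inr _), Sum.inl (h, x), r =>
      if x = Sum.inr () ∧ r = Sum.inl (g + h, Sum.inr ()) then 1 else 0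
  | Sum.inl (g, Sum.inl k), Sum.inr (Sum.inl k'), r =>
      if k = k' ∧ r = Sum.inr (Sum.inl (k' - g)) then 1 else 0
  | Sum.inl (_, Sum.inr _), Sum.inr (Sum.inl _), _ => 0
  | Sum.inl (_, Sum.inl _), Sum.inr (Sum.inr _), _ => 0
  | Sum.inl (g, Sum.inr _), Sum.inr (Sum.inr k'), r =>
      if r = Sum.inr (Sum.inr k') then χ g k' else 0
  | Sum.inr (Sum.inl k), Sum.inl (g, x), r =>
      if x = Sum.inr () ∧ r = Sum.inr (Sum.inl k) then χ g k else 0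
  | Sum.inr (Sum.inr k), Sum.inl (g, x), r =>
      if x = Sum.inl (g + k) ∧ r = Sum.inr (Sum.inr (g + k)) then 1 else 0
  | Sum.inr (Sum.inl h), Sum.inr (Sum.inr k), r =>
      if r = Sum.inl (k - h, Sum.inl k) then 1 else 0
  | Sum.inr (Sum.inr h), Sum.inr (Sum.inl k), r =>
      if h = k then
        (match r with
          | Sum.inl (g, Sum.inr _) => (τ : ℂ) * (χ g h)⁻¹
          | _ => 0)
      else 0
  | Sum.inr (Sum.inl _), Sum.inr (Sum.inl _), _ => 0
  | Sum.inr (Sum.inr _), Sum.inr (Sum.inr _), _ => 0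

/-- The multiplication of the Tambara–Yamagami WHA:
`f^x_{α,β} f^y_{γ,δ} = (v^x_α ∘ v^y_γ) ⊗ conj (v^x_β ∘ v^y_δ)`. -/
def mulTY (χ : G → G → ℂ) (τ : ℝ) (f f' : TYB G) : TYB G := fun r =>
  ∑ p : BIdx G, ∑ q : BIdx G,
    f p * f' q * circC G χ τ p.1.1 q.1.1 r.1.1 * star (circC G χ τ p.1.2 q.1.2 r.1.2)

/-- The unit `1 = Σ_{z,w ∈ Ω} f^0_{z,w}` of the Tambara–Yamagami WHA. -/
def oneTY : TYB G := fun r =>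
  match r.1.1 with
  | Sum.inl (g, _) => if g = 0 then 1 else 0
  | Sum.inr _ => 0

/-- Structure constants of the coproduct: `Δ(f^x_{α,β}) = Σ_γ f^x_{α,γ} ⊗ f^x_{γ,β}`. -/
def Δc : BIdx G → BIdx G → BIdx G → ℂ := fun p q r =>
  if q.1.1 = p.1.1 ∧ r.1.2 = p.1.2 ∧ q.1.2 = r.1.1 then 1 else 0

/-- The coproduct, with `B ⊗ B` realized as `BIdx × BIdx → ℂ`. -/
def ΔTY (f : TYB G) : BIdx G × BIdx G → ℂ := fun qr => ∑ p : BIdx G, f p * Δc G p qr.1 qr.2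

/-- The counit `ε(f^x_{α,β}) = δ_{α,β}`. -/
def εTY (f : TYB G) : ℂ := ∑ p : BIdx G, f p * (if p.1.1 = p.1.2 then 1 else 0)

/-- Translation of an index in `Ω` (`m` unaffected). -/
def shiftΩ : ΩIdx G → G → ΩIdx G
  | Sum.inl h, g => Sum.inl (h - g)
  | Sum.inr u, _ => Sum.inr u

/-- Structure constants of the involution `*`. -/
def starCoef (τ : ℝ) : BIdx G → BIdx G → ℂ := fun p r =>
  match p.1, r.1 with
  | (Sum.inl (g, a), Sum.inl (g', b)), (Sum.inl (g₂, a₂), Sum.inl (g₂', b₂)) =>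
      if g₂ = -g ∧ g₂' = -g' ∧ a₂ = shiftΩ G a g ∧ b₂ = shiftΩ G b g' then 1 else 0
  | (Sum.inr α, Sum.inr β), (Sum.inr α₂, Sum.inr β₂) =>
      if α₂ = α.swap ∧ β₂ = β.swap then
        (match α, β with
          | Sum.inl _, Sum.inr _ => (τ : ℂ)
          | Sum.inr _, Sum.inl _ => (τ : ℂ)⁻¹
          | _, _ => 1)
      else 0
  | _, _ => 0

/-- The (conjugate-linear) involution of the Tambara–Yamagami WHA. -/
def starTY (τ : ℝ) (f : TYB G) : TYB G := fun r =>
  ∑ p : BIdx G, (starRingEnd ℂ) (f p) * starCoef G τ p r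

/-- Structure constants of the antipode `S`. -/
def SCoef (τ : ℝ) : BIdx G → BIdx G → ℂ := fun p r =>
  match p.1, r.1 with
  | (Sum.inl (g, a), Sum.inl (_, b)), (Sum.inl (g₂, a₂), Sum.inl (g₂', b₂)) =>
      if g₂ = -g ∧ g₂' = -g ∧ a₂ = shiftΩ G b g ∧ b₂ = shiftΩ G a g then 1 else 0
  | (Sum.inr α, Sum.inr β), (Sum.inr α₂, Sum.inr β₂) =>
      if α₂ = β.swap ∧ β₂ = α.swap then
        (match α, β with
          | Sum.inl _, Sum.inr _ => (τ : ℂ)⁻¹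
          | Sum.inr _, Sum.inl _ => (τ : ℂ)
          | _, _ => 1)
      else 0
  | _, _ => 0

/-- The antipode of the Tambara–Yamagami WHA. -/
def STY (τ : ℝ) (f : TYB G) : TYB G := fun r => ∑ p : BIdx G, f p * SCoef G τ p r

/-- The right adjoint action `a ◁ x = S(x₍₁₎) a x₍₂₎`. -/
def adTY (χ : G → G → ℂ) (τ : ℝ) (a x : TYB G) : TYB G :=
  ∑ p : BIdx G, ∑ q₁ : BIdx G, ∑ q₂ : BIdx G,
    (x p * Δc G p q₁ q₂) •
      mulTY G χ τ (mulTY G χ τ (STY G τ (Pi.single q₁ 1)) a) (Pi.single q₂ 1)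

/-- `I` is a coideal of the Tambara–Yamagami WHA: a unital `*`-subalgebra with
`Δ(I) ⊆ I ⊗ B`. -/
def IsCoidealTY (χ : G → G → ℂ) (τ : ℝ) (I : Submodule ℂ (TYB G)) : Prop :=
  oneTY G ∈ I ∧ (∀ a ∈ I, ∀ b ∈ I, mulTY G χ τ a b ∈ I) ∧ (∀ a ∈ I, starTY G τ a ∈ I) ∧
    ∀ a ∈ I, ΔTY G a ∈ Submodule.span ℂ
      {t : BIdx G × BIdx G → ℂ | ∃ u ∈ I, ∃ v : TYB G, t = fun qr => u qr.1 * v qr.2}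

/-- `I` is invariant: `span{S(x₍₁₎) a x₍₂₎ : a ∈ I, x ∈ B} = I`. -/
def IsInvariantTY (χ : G → G → ℂ) (τ : ℝ) (I : Submodule ℂ (TYB G)) : Prop :=
  Submodule.span ℂ {y : TYB G | ∃ a ∈ I, ∃ x : TYB G, y = adTY G χ τ a x} = I

/-- The source counital map `ε_s(b) = (id ⊗ ε)((1 ⊗ b)Δ(1))`. -/
def εsTY (χ : G → G → ℂ) (τ : ℝ) (b : TYB G) : TYB G := fun s =>
  ∑ r : BIdx G, (ΔTY G (oneTY G) (s, r)) * εTY G (mulTY G χ τ b (Pi.single r 1))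

/-- `B_s = ε_s(B)`. -/
def BsTY (χ : G → G → ℂ) (τ : ℝ) : Submodule ℂ (TYB G) :=
  Submodule.span ℂ (Set.range (εsTY G χ τ))

/-- `L^⊥ = {g : χ(g,l) = 1 ∀ l ∈ L}`. -/
def Lperp (χ : G → G → ℂ) (L : AddSubgroup G) : Set G := {g : G | ∀ l ∈ L, χ g l = 1}

/-- The element `v^0_Y ⊗ conj (v^0_w)` of `B`, for `Y ⊆ G` and `w ∈ Ω`. -/
def bCoset (Y : Set G) (w : ΩIdx G) : TYB G := fun p =>
  match p.1 with
  | (Sum.inl (g, Sum.inl y), Sum.inl (g', w')) =>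
      if g = 0 ∧ g' = 0 ∧ w' = w ∧ y ∈ Y then 1 else 0
  | _ => 0

/-- The element `v^l_m ⊗ conj (v^l_w)` of `B`, for `l ∈ G` and `w ∈ Ω`. -/
def bM (l : G) (w : ΩIdx G) : TYB G := fun p =>
  match p.1 with
  | (Sum.inl (g, Sum.inr _), Sum.inl (g', w')) => if g = l ∧ g' = l ∧ w' = w then 1 else 0
  | _ => 0

/-- The coideal `I^L = span{v^0_Y : Y ∈ G/L} ⊗ conj(H^0) ⊕ Σ_{l ∈ L^⊥} ℂ v^l_m ⊗ conj(H^l)`. -/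
def ILTY (χ : G → G → ℂ) (L : AddSubgroup G) : Submodule ℂ (TYB G) :=
  Submodule.span ℂ
    ({b : TYB G | ∃ g : G, ∃ w : ΩIdx G, b = bCoset G {x : G | x - g ∈ L} w} ∪
      {b : TYB G | ∃ l ∈ Lperp G χ L, ∃ w : ΩIdx G, b = bM G l w})


/-- `x ↦ I^x` on the extended lattice `Subgrp(G) ⊔ {Ω}`. -/
def ILext (χ : G → G → ℂ) (τ : ℝ) : (AddSubgroup G ⊕ Unit) → Submodule ℂ (TYB G)
  | Sum.inl L => ILTY G χ L
  | Sum.inr _ => BsTY G χ τ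

/-- The order of the extended lattice `Subgrp(G) ⊔ {Ω}` (`Ω` is the largest element). -/
def extLe : (AddSubgroup G ⊕ Unit) → (AddSubgroup G ⊕ Unit) → Prop
  | Sum.inl L, Sum.inl K => L ≤ K
  | _, Sum.inr _ => True
  | Sum.inr _, Sum.inl _ => False

/-- The `*`-subalgebra (as a subspace) of the Tambara–Yamagami WHA generated by a set. -/
def starSubalgGen (χ : G → G → ℂ) (τ : ℝ) (s : Set (TYB G)) : Submodule ℂ (TYB G) :=
  sInf {J : Submodule ℂ (TYB G) | s ⊆ J ∧ oneTY G ∈ J ∧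
    (∀ a ∈ J, ∀ b ∈ J, mulTY G χ τ a b ∈ J) ∧ ∀ a ∈ J, starTY G τ a ∈ J}

end TY

section TYAux

set_option linter.unusedSectionVars false

variable {G : Type} [AddCommGroup G] [Fintype G] [DecidableEq G]

/-- The elementary tensor `u ⊗ conj w`, projected to the diagonal grades. -/
def tens (u w : TYV G) : TYB G := fun p => u p.1.1 * star (w p.1.2)

/-- The basis vector of `V` with index `a`. -/
def basisV (a : VIdx G) : TYV G := Pi.single a 1

/-- `u` is homogeneous of grade `x`. -/
def IsHomog (x : ΩIdx G) (u : TYV G) : Prop := ∀ c, tyGrade G c ≠ x → u c = 0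

/-- The component of grade `x`. -/
def gradeProj (x : ΩIdx G) : TYV G →ₗ[ℂ] TYV G where
  toFun u c := if tyGrade G c = x then u c else 0
  map_add' u v := by ext c; simp only [Pi.add_apply]; split_ifs <;> simp
  map_smul' k u := by ext c; simp

/-- The column of `b ∈ B` with index `β`. -/
def colB (β : VIdx G) : TYB G →ₗ[ℂ] TYV G where
  toFun b α := if h : tyGrade G α = tyGrade G β then b ⟨(α, β), h⟩ else 0
  map_add' u v := by ext c; simp only [Pi.add_apply]; split_ifs <;> simp
  map_smul' k u := by ext c; simp

/-- The product `∘` of `V`. -/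
def circ (χ : G → G → ℂ) (τ : ℝ) : TYV G →ₗ[ℂ] TYV G →ₗ[ℂ] TYV G :=
  LinearMap.mk₂ ℂ (fun u v c => ∑ a, ∑ b, u a * v b * circC G χ τ a b c)
    (fun u u' v => by ext c; simp [add_mul, Finset.sum_add_distrib])
    (fun k u v => by ext c; simp only [Pi.smul_apply, smul_eq_mul, Finset.mul_sum, mul_assoc])
    (fun u v v' => by ext c; simp [add_mul, mul_add, Finset.sum_add_distrib])
    (fun k u v => by ext c; simp only [Pi.smul_apply, smul_eq_mul, Finset.mul_sum, mul_assoc, mul_left_comm k])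

/-- The product of `B` as a bilinear map. -/
def mulB (χ : G → G → ℂ) (τ : ℝ) : TYB G →ₗ[ℂ] TYB G →ₗ[ℂ] TYB G :=
  LinearMap.mk₂ ℂ (mulTY G χ τ)
    (fun u u' v => by ext c; simp [mulTY, add_mul, Finset.sum_add_distrib])
    (fun k u v => by ext c; simp [mulTY, Finset.mul_sum, mul_assoc])
    (fun u v v' => by ext c; simp [mulTY, add_mul, mul_add, Finset.sum_add_distrib])
    (fun k u v => by ext c; simp [mulTY, Finset.mul_sum, mul_assoc, mul_left_comm])

lemma mulB_apply (χ : G → G → ℂ) (τ : ℝ) (a b : TYB G) : mulB χ τ a b = mulTY G χ τ a b := rfl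

lemma circ_apply (χ : G → G → ℂ) (τ : ℝ) (u v : TYV G) (c : VIdx G) :
    circ χ τ u v c = ∑ a, ∑ b, u a * v b * circC G χ τ a b c := rfl

lemma gradeProj_apply (x : ΩIdx G) (u : TYV G) (c : VIdx G) :
    gradeProj x u c = if tyGrade G c = x then u c else 0 := rfl

lemma colB_apply (β : VIdx G) (b : TYB G) (α : VIdx G) :
    colB β b α = if h : tyGrade G α = tyGrade G β then b ⟨(α, β), h⟩ else 0 := rfl

lemma basisV_apply (a c : VIdx G) : basisV a c = if c = a then 1 else 0 := by
  simp [basisV, Pi.single_apply]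

lemma circ_basisV (χ : G → G → ℂ) (τ : ℝ) (a b : VIdx G) :
    circ χ τ (basisV a) (basisV b) = circC G χ τ a b := by
  ext c
  simp [circ_apply, basisV_apply]

lemma isHomog_basisV (a : VIdx G) : IsHomog (tyGrade G a) (basisV a) := by
  intro c hc
  rw [basisV_apply, if_neg]
  rintro rfl
  exact hc rfl

lemma isHomog_gradeProj (x : ΩIdx G) (u : TYV G) : IsHomog x (gradeProj x u) := by
  intro c hc
  rw [gradeProj_apply, if_neg hc]

lemma isHomog_colB (β : VIdx G) (b : TYB G) : IsHomog (tyGrade G β) (colB β b) := by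
  intro c hc
  rw [colB_apply, dif_neg hc]

lemma IsHomog.gradeProj_eq {x : ΩIdx G} {u : TYV G} (hu : IsHomog x u) : gradeProj x u = u := by
  ext c
  rw [gradeProj_apply]
  split_ifs with h
  · rfl
  · exact (hu c h).symm

lemma sum_basisV (u : TYV G) : u = ∑ a, u a • basisV a := by
  ext c
  simp [basisV_apply]

lemma sum_gradeProj (u : TYV G) : u = ∑ x, gradeProj x u := by
  ext c
  simp [gradeProj_apply]

lemma tens_add_left (u u' w : TYV G) : tens (u + u') w = tens u w + tens u' w := by
  ext p; simp [tens, add_mul]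

lemma tens_smul_left (k : ℂ) (u w : TYV G) : tens (k • u) w = k • tens u w := by
  ext p; simp [tens, mul_assoc]

lemma tens_zero_left (w : TYV G) : tens 0 w = 0 := by
  ext p; simp [tens]

lemma tens_sum_left {ι : Type*} (s : Finset ι) (u : ι → TYV G) (w : TYV G) :
    tens (∑ i ∈ s, u i) w = ∑ i ∈ s, tens (u i) w := by
  ext p; simp [tens, Finset.sum_mul]

lemma tens_smul_right (k : ℂ) (u w : TYV G) : tens u (k • w) = star k • tens u w := by
  ext p; simp [tens, mul_left_comm]

lemma tens_sum_right {ι : Type*} (s : Finset ι) (u : TYV G) (w : ι → TYV G) :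
    tens u (∑ i ∈ s, w i) = ∑ i ∈ s, tens u (w i) := by
  ext p; simp [tens, Finset.mul_sum]

lemma tens_gradeProj {x : ΩIdx G} (u : TYV G) {w : TYV G} (hw : IsHomog x w) :
    tens (gradeProj x u) w = tens u w := by
  ext p
  simp only [tens, gradeProj_apply]
  split_ifs with h
  · rfl
  · rw [hw p.1.2 (by rw [← p.2]; exact h)]; simp

lemma tens_eq_zero {x y : ΩIdx G} (hxy : x ≠ y) {u w : TYV G} (hu : IsHomog x u)
    (hw : IsHomog y w) : tens u w = 0 := by
  ext p
  simp only [tens, Pi.zero_apply]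
  by_cases h : tyGrade G p.1.1 = x
  · rw [hw p.1.2 (by rw [← p.2, h]; exact hxy)]; simp
  · rw [hu _ h]; simp

lemma single_eq_tens (p : BIdx G) :
    (Pi.single p 1 : TYB G) = tens (basisV p.1.1) (basisV p.1.2) := by
  ext q
  simp only [Pi.single_apply, tens, basisV_apply, Subtype.ext_iff, Prod.ext_iff]
  by_cases h1 : q.1.1 = p.1.1 <;> by_cases h2 : q.1.2 = p.1.2 <;> simp [h1, h2]

lemma sum_tens_colB (b : TYB G) : b = ∑ β, tens (colB β b) (basisV β) := by
  ext p
  simp only [Finset.sum_apply, tens, basisV_apply]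
  rw [Finset.sum_eq_single p.1.2]
  · simp [colB_apply, p.2]
  · intro β _ hβ
    simp [Ne.symm hβ]
  · simp

lemma colB_tens (β : VIdx G) (u w : TYV G) :
    colB β (tens u w) = star (w β) • gradeProj (tyGrade G β) u := by
  ext α
  simp only [colB_apply, tens, Pi.smul_apply, gradeProj_apply, smul_eq_mul]
  split_ifs <;> ring

lemma sum_BIdx {M : Type*} [AddCommMonoid M] (F : VIdx G → VIdx G → M)
    (hF : ∀ a b, tyGrade G a ≠ tyGrade G b → F a b = 0) :
    ∑ p : BIdx G, F p.1.1 p.1.2 = ∑ a, ∑ b, F a b := by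
  rw [← Fintype.sum_prod_type' F, ← Finset.sum_filter_of_ne
    (p := fun q : VIdx G × VIdx G => tyGrade G q.1 = tyGrade G q.2)
    fun q _ hq => not_imp_comm.1 (hF q.1 q.2) hq]
  exact (Finset.sum_subtype _ (by simp) fun q : VIdx G × VIdx G => F q.1 q.2).symm

lemma mulTY_tens (χ : G → G → ℂ) (τ : ℝ) {x y : ΩIdx G} {u w u' w' : TYV G}
    (hu : IsHomog x u) (hw : IsHomog x w) (hu' : IsHomog y u') (hw' : IsHomog y w') :
    mulTY G χ τ (tens u w) (tens u' w') = tens (circ χ τ u u') (circ χ τ w w') := by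
  have key : ∀ {x : ΩIdx G} {u w : TYV G}, IsHomog x u → IsHomog x w →
      ∀ a b, tyGrade G a ≠ tyGrade G b → u a * star (w b) = 0 := by
    intro x u w hu hw a b hab
    by_cases h : tyGrade G a = x
    · rw [hw b (by rw [← h]; exact hab.symm)]; simp
    · rw [hu a h]; simp
  ext r
  simp only [mulTY, tens]
  rw [sum_BIdx (fun p p' => ∑ q : BIdx G, u p * star (w p') * (u' q.1.1 * star (w' q.1.2)) *
    circC G χ τ p q.1.1 r.1.1 * star (circC G χ τ p' q.1.2 r.1.2))]
  · simp_rw [circ_apply, star_sum, Finset.sum_mul_sum]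
    refine Finset.sum_congr rfl fun a _ => ?_
    refine Finset.sum_congr rfl fun c _ => ?_
    rw [sum_BIdx (fun q q' => u a * star (w c) * (u' q * star (w' q')) *
      circC G χ τ a q r.1.1 * star (circC G χ τ c q' r.1.2))]
    · simp_rw [star_mul']
      refine Finset.sum_congr rfl fun b _ => Finset.sum_congr rfl fun d _ => ?_
      ring
    · intro q q' h
      rw [key hu' hw' q q' h]; ring
  · intro a b h
    apply Finset.sum_eq_zero
    intro q _
    rw [key hu hw a b h]; ring

/-- The index of the dual basis vector occurring in the antipode. -/
def barV : VIdx G → VIdx G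
  | Sum.inl (g, a) => Sum.inl (-g, shiftΩ G a g)
  | Sum.inr α => Sum.inr α.swap

/-- The scalar occurring in `S (f_{α,γ})`. -/
def antiCoef (τ : ℝ) : VIdx G → VIdx G → ℂ
  | Sum.inl (g, _), Sum.inl (h, _) => if g = h then 1 else 0
  | Sum.inr (Sum.inl _), Sum.inr (Sum.inr _) => (τ : ℂ)⁻¹
  | Sum.inr (Sum.inr _), Sum.inr (Sum.inl _) => (τ : ℂ)
  | Sum.inr _, Sum.inr _ => 1
  | _, _ => 0

lemma antiCoef_of_grade_ne (τ : ℝ) {a b : VIdx G} (h : tyGrade G a ≠ tyGrade G b) :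
    antiCoef τ a b = 0 := by
  rcases a with ⟨g, a⟩ | (a | a) <;> rcases b with ⟨g', b⟩ | (b | b) <;>
    simp_all [antiCoef, tyGrade]

lemma STY_single (τ : ℝ) (p : BIdx G) :
    STY G τ (Pi.single p 1) =
      antiCoef τ p.1.1 p.1.2 • tens (basisV (barV p.1.2)) (basisV (barV p.1.1)) := by
  ext r
  have h : STY G τ (Pi.single p 1) r = SCoef G τ p r := by
    rw [STY, Finset.sum_eq_single p]
    · simp
    · intro q _ hq
      simp [hq]
    · simp
  rw [h, Pi.smul_apply, smul_eq_mul, tens, basisV_apply, basisV_apply]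
  obtain ⟨⟨p1, p2⟩, hp⟩ := p
  obtain ⟨⟨r1, r2⟩, hr⟩ := r
  clear h
  rcases p1 with ⟨g, a⟩ | (a | a) <;> rcases p2 with ⟨g', b⟩ | (b | b) <;>
    simp [tyGrade] at hp <;>
    rcases r1 with ⟨g₂, a₂⟩ | (a₂ | a₂) <;> rcases r2 with ⟨g₂', b₂⟩ | (b₂ | b₂) <;>
    simp [tyGrade] at hr <;> simp [SCoef, antiCoef, barV] <;> grind

lemma tyGrade_barV {a b : VIdx G} (h : tyGrade G a = tyGrade G b) :
    tyGrade G (barV a) = tyGrade G (barV b) := by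
  rcases a with ⟨g, a⟩ | (a | a) <;> rcases b with ⟨g', b⟩ | (b | b) <;>
    simp_all [barV, tyGrade]

/-- The source of a basis vector. -/
def lidx : VIdx G → ΩIdx G
  | Sum.inl (g, y) => shiftΩ G y g
  | Sum.inr (Sum.inl k) => Sum.inl k
  | Sum.inr (Sum.inr _) => Sum.inr ()

/-- The target of a basis vector. -/
def ridx : VIdx G → ΩIdx G
  | Sum.inl (_, y) => y
  | Sum.inr (Sum.inl _) => Sum.inr ()
  | Sum.inr (Sum.inr k) => Sum.inl k

lemma lidx_barV (a : VIdx G) : lidx (barV a) = ridx a := by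
  rcases a with ⟨g, a | a⟩ | (a | a) <;> simp [barV, lidx, ridx, shiftΩ]

lemma idx_of_circC_ne_zero {χ : G → G → ℂ} {τ : ℝ} {a b c : VIdx G}
    (h : circC G χ τ a b c ≠ 0) : lidx c = lidx a ∧ ridx c = ridx b := by
  rcases a with ⟨g, a | a⟩ | (a | a) <;> rcases b with ⟨g', b | b⟩ | (b | b) <;>
    rcases c with ⟨g'', c | c⟩ | (c | c) <;> simp [circC, lidx, ridx, shiftΩ] at h ⊢ <;> grind

lemma exists_of_mulTY_ne_zero {χ : G → G → ℂ} {τ : ℝ} {f f' : TYB G} {r : BIdx G}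
    (h : mulTY G χ τ f f' r ≠ 0) :
    ∃ p q : BIdx G, f p ≠ 0 ∧ f' q ≠ 0 ∧ circC G χ τ p.1.1 q.1.1 r.1.1 ≠ 0 := by
  obtain ⟨p, _, hp⟩ := Finset.exists_ne_zero_of_sum_ne_zero h
  obtain ⟨q, _, hq⟩ := Finset.exists_ne_zero_of_sum_ne_zero hp
  refine ⟨p, q, ?_, ?_, ?_⟩ <;> intro h0 <;> simp [h0] at hq

lemma idx_of_adTY_ne_zero {χ : G → G → ℂ} {τ : ℝ} {a x : TYB G} {r : BIdx G}
    (h : adTY G χ τ a x r ≠ 0) : lidx r.1.1 = ridx r.1.1 := by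
  simp only [adTY, Finset.sum_apply] at h
  obtain ⟨p, _, hp⟩ := Finset.exists_ne_zero_of_sum_ne_zero h
  obtain ⟨q₁, _, hq₁⟩ := Finset.exists_ne_zero_of_sum_ne_zero hp
  obtain ⟨q₂, _, hq₂⟩ := Finset.exists_ne_zero_of_sum_ne_zero hq₁
  simp only [Pi.smul_apply, smul_eq_mul, ne_eq, mul_eq_zero, not_or] at hq₂
  obtain ⟨⟨-, hΔ⟩, hm⟩ := hq₂
  have hΔ' : q₁.1.2 = q₂.1.1 := by
    by_contra hne
    simp [Δc, hne] at hΔ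
  obtain ⟨s, t, hs, ht, hst⟩ := exists_of_mulTY_ne_zero hm
  obtain ⟨s', t', hs', -, hst'⟩ := exists_of_mulTY_ne_zero hs
  have h1 : t = q₂ := by
    by_contra hne
    simp [hne] at ht
  have h2 : s'.1.1 = barV q₁.1.2 := by
    by_contra hne
    simp [STY_single, tens, basisV_apply, hne] at hs'
  rw [(idx_of_circC_ne_zero hst).2, (idx_of_circC_ne_zero hst).1, (idx_of_circC_ne_zero hst').1,
    h1, h2, lidx_barV, hΔ']

lemma isHomog_circ_inl {χ : G → G → ℂ} {τ : ℝ} {x : ΩIdx G} {g : G} {u v : TYV G}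
    (hu : IsHomog x u) (hv : IsHomog (Sum.inl g) v) :
    IsHomog (x.map (· + g) id) (circ χ τ u v) := by
  intro c hc
  rw [circ_apply]
  refine Finset.sum_eq_zero fun a _ => Finset.sum_eq_zero fun b _ => ?_
  by_cases ha : tyGrade G a = x
  · by_cases hb : tyGrade G b = Sum.inl g
    · have : circC G χ τ a b c = 0 := by
        subst ha
        rcases a with ⟨g, a | a⟩ | (a | a) <;> rcases b with ⟨g', b | b⟩ | (b | b) <;>
          rcases c with ⟨g'', c | c⟩ | (c | c) <;> simp_all [circC, tyGrade]
      rw [this]; simp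
    · rw [hv b hb]; simp
  · rw [hu a ha]; simp

/-- The action of the right adjoint representation on the first tensor factor. -/
def adV (χ : G → G → ℂ) (τ : ℝ) (α : VIdx G) : TYV G →ₗ[ℂ] TYV G :=
  ∑ γ, antiCoef τ α γ • (circ χ τ).flip (basisV γ) ∘ₗ circ χ τ (basisV (barV γ))

lemma adV_apply (χ : G → G → ℂ) (τ : ℝ) (α : VIdx G) (u : TYV G) :
    adV χ τ α u =
      ∑ γ, antiCoef τ α γ • circ χ τ (circ χ τ (basisV (barV γ)) u) (basisV γ) := by
  simp [adV]

lemma adTY_single (χ : G → G → ℂ) (τ : ℝ) (a : TYB G) (p : BIdx G) :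
    adTY G χ τ a (Pi.single p 1) = ∑ q₁ : BIdx G, ∑ q₂ : BIdx G, Δc G p q₁ q₂ •
      mulTY G χ τ (mulTY G χ τ (STY G τ (Pi.single q₁ 1)) a) (Pi.single q₂ 1) := by
  rw [adTY, Finset.sum_eq_single p]
  · simp
  · intro p' _ hp
    simp [hp]
  · simp

lemma adTY_eq_sum (χ : G → G → ℂ) (τ : ℝ) (a x : TYB G) :
    adTY G χ τ a x = ∑ p, x p • adTY G χ τ a (Pi.single p 1) := by
  simp_rw [adTY_single, Finset.smul_sum, smul_smul]
  rfl

lemma adTY_add (χ : G → G → ℂ) (τ : ℝ) (a b x : TYB G) :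
    adTY G χ τ (a + b) x = adTY G χ τ a x + adTY G χ τ b x := by
  simp_rw [adTY, ← mulB_apply, map_add, LinearMap.add_apply, smul_add, Finset.sum_add_distrib]

lemma adTY_zero (χ : G → G → ℂ) (τ : ℝ) (x : TYB G) : adTY G χ τ 0 x = 0 := by
  simp_rw [adTY, ← mulB_apply, map_zero, LinearMap.zero_apply, smul_zero, Finset.sum_const_zero]

lemma adTY_tens (χ : G → G → ℂ) (τ : ℝ) {g : G} {u w : TYV G} (hu : IsHomog (Sum.inl g) u)
    (hw : IsHomog (Sum.inl g) w) (p : BIdx G) :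
    adTY G χ τ (tens u w) (Pi.single p 1) =
      tens (adV χ τ p.1.1 u) (circ χ τ (circ χ τ (basisV (barV p.1.1)) w) (basisV p.1.2)) := by
  obtain ⟨⟨α, β⟩, hp⟩ := p
  rw [adTY_single, adV_apply, tens_sum_left]
  have hterm : ∀ q₁ q₂ : BIdx G, Δc G ⟨(α, β), hp⟩ q₁ q₂ •
      mulTY G χ τ (mulTY G χ τ (STY G τ (Pi.single q₁ 1)) (tens u w)) (Pi.single q₂ 1) =
      (if q₁.1.1 = α ∧ q₂.1.2 = β ∧ q₁.1.2 = q₂.1.1 then antiCoef τ q₁.1.1 q₁.1.2 else 0) •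
      tens (circ χ τ (circ χ τ (basisV (barV q₁.1.2)) u) (basisV q₂.1.1))
        (circ χ τ (circ χ τ (basisV (barV q₁.1.1)) w) (basisV q₂.1.2)) := by
    intro q₁ q₂
    have h1 := tyGrade_barV q₁.2
    have h3 := isHomog_basisV (barV q₁.1.1)
    rw [h1] at h3
    have h4 := isHomog_basisV q₂.1.1
    rw [q₂.2] at h4
    rw [STY_single, single_eq_tens, ← mulB_apply, ← mulB_apply, map_smul, LinearMap.smul_apply,
      map_smul, LinearMap.smul_apply, mulB_apply, mulB_apply,
      mulTY_tens χ τ (isHomog_basisV _) h3 hu hw,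
      mulTY_tens χ τ (isHomog_circ_inl (isHomog_basisV _) hu) (isHomog_circ_inl h3 hw) h4
        (isHomog_basisV _), smul_smul]
    simp [Δc]
  simp_rw [hterm]
  rw [sum_BIdx (fun a c => ∑ q₂ : BIdx G,
    (if a = α ∧ q₂.1.2 = β ∧ c = q₂.1.1 then antiCoef τ a c else 0) •
      tens (circ χ τ (circ χ τ (basisV (barV c)) u) (basisV q₂.1.1))
        (circ χ τ (circ χ τ (basisV (barV a)) w) (basisV q₂.1.2)))]
  · rw [Finset.sum_eq_single α (by intro b _ hb; simp [hb]) (by simp)]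
    refine Finset.sum_congr rfl fun γ _ => ?_
    rw [tens_smul_left]
    by_cases hγ : tyGrade G α = tyGrade G γ
    · rw [Finset.sum_eq_single (⟨(γ, β), hγ ▸ hp⟩ : BIdx G)]
      · simp
      · intro q _ hq
        rw [if_neg, zero_smul]
        rintro ⟨-, h1, h2⟩
        exact hq (Subtype.ext (Prod.ext h2.symm h1))
      · simp
    · simp [antiCoef_of_grade_ne τ hγ]
  · intro a c h
    simp [antiCoef_of_grade_ne τ h]

/-- The vector `Σ_k φ(k) v^0_k + Σ_g ψ(g) v^g_m`. -/
def embV : ((G → ℂ) × (G → ℂ)) →ₗ[ℂ] TYV G where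
  toFun f c := match c with
    | Sum.inl (g, Sum.inl k) => if g = 0 then f.1 k else 0
    | Sum.inl (g, Sum.inr _) => f.2 g
    | Sum.inr _ => 0
  map_add' f f' := by
    ext c; rcases c with ⟨g, k | k⟩ | (k | k) <;> simp only [Pi.add_apply, Prod.fst_add, Prod.snd_add, add_zero]
    split_ifs <;> simp
  map_smul' a f := by
    ext c; rcases c with ⟨g, k | k⟩ | (k | k) <;> simp

lemma embV_apply (f : (G → ℂ) × (G → ℂ)) (c : VIdx G) :
    embV f c = match c with
    | Sum.inl (g, Sum.inl k) => if g = 0 then f.1 k else 0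
    | Sum.inl (g, Sum.inr _) => f.2 g
    | Sum.inr _ => 0 := rfl

lemma embV_eq_sum (f : (G → ℂ) × (G → ℂ)) :
    embV f = ∑ k, f.1 k • basisV (Sum.inl (0, Sum.inl k)) +
      ∑ g, f.2 g • basisV (Sum.inl (g, Sum.inr ())) := by
  ext c
  rcases c with ⟨g, k | k⟩ | (k | k) <;>
    simp [embV_apply, basisV_apply, Finset.sum_apply]
  split_ifs <;> simp [*]

lemma embV_injective : Function.Injective (embV (G := G)) := by
  intro f f' h
  ext k
  · simpa [embV_apply] using congrFun h (Sum.inl (0, Sum.inl k))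
  · simpa [embV_apply] using congrFun h (Sum.inl (k, Sum.inr ()))

lemma eq_embV {u : TYV G} (hu : ∀ c, lidx c ≠ ridx c → u c = 0) :
    u = embV (fun k => u (Sum.inl (0, Sum.inl k)), fun g => u (Sum.inl (g, Sum.inr ()))) := by
  ext c
  rcases c with ⟨g, k | k⟩ | (k | k) <;> simp only [embV_apply]
  · split_ifs with h
    · rw [h]
    · exact hu _ (by simpa [lidx, ridx, shiftΩ] using h)
  · exact hu _ (by simp [lidx, ridx])
  · exact hu _ (by simp [lidx, ridx])

section Table

variable (χ : G → G → ℂ) (τ : ℝ)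

lemma circ_inl_inl_inl (g h k : G) (x : ΩIdx G) :
    circ χ τ (basisV (Sum.inl (g, Sum.inl k))) (basisV (Sum.inl (h, x))) =
      if x = Sum.inl (h + k) then basisV (Sum.inl (g + h, Sum.inl (h + k))) else 0 := by
  rw [circ_basisV]; ext c; split_ifs with hx <;> simp [circC, basisV_apply, hx]

lemma circ_inl_inr_inl (g h : G) (x : ΩIdx G) :
    circ χ τ (basisV (Sum.inl (g, Sum.inr ()))) (basisV (Sum.inl (h, x))) =
      if x = Sum.inr () then basisV (Sum.inl (g + h, Sum.inr ())) else 0 := by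
  rw [circ_basisV]; ext c; split_ifs with hx <;> simp [circC, basisV_apply, hx]

lemma circ_inr_inl_inl (g k : G) (x : ΩIdx G) :
    circ χ τ (basisV (Sum.inr (Sum.inl k))) (basisV (Sum.inl (g, x))) =
      if x = Sum.inr () then χ g k • basisV (Sum.inr (Sum.inl k)) else 0 := by
  rw [circ_basisV]; ext c; split_ifs with hx <;> simp [circC, basisV_apply, hx]

lemma circ_inr_inr_inl (g k : G) (x : ΩIdx G) :
    circ χ τ (basisV (Sum.inr (Sum.inr k))) (basisV (Sum.inl (g, x))) =
      if x = Sum.inl (g + k) then basisV (Sum.inr (Sum.inr (g + k))) else 0 := by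
  rw [circ_basisV]; ext c; split_ifs with hx <;> simp [circC, basisV_apply, hx]

lemma circ_inr_inl_inr_inr (h k : G) :
    circ χ τ (basisV (Sum.inr (Sum.inl h))) (basisV (Sum.inr (Sum.inr k))) =
      basisV (Sum.inl (k - h, Sum.inl k)) := by
  rw [circ_basisV]; ext c; simp [circC, basisV_apply]

lemma circ_inr_inr_inr_inl (h k : G) :
    circ χ τ (basisV (Sum.inr (Sum.inr h))) (basisV (Sum.inr (Sum.inl k))) =
      if h = k then embV (0, fun g => (τ : ℂ) * (χ g h)⁻¹) else 0 := by
  rw [circ_basisV]; ext c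
  rcases c with ⟨g, c | c⟩ | (c | c) <;> split_ifs with hx <;> simp [circC, embV_apply, hx]

lemma circ_embV (f f' : (G → ℂ) × (G → ℂ)) :
    circ χ τ (embV f) (embV f') =
      embV (fun k => f.1 k * f'.1 k, fun g => ∑ h, f.2 h * f'.2 (g - h)) := by
  rw [embV_eq_sum f, embV_eq_sum f', embV_eq_sum]
  simp only [map_add, map_sum, map_smul, LinearMap.add_apply, LinearMap.sum_apply,
    LinearMap.smul_apply, circ_inl_inl_inl, circ_inl_inr_inl]
  simp only [zero_add, Sum.inl.injEq, smul_ite, smul_zero, Finset.mem_univ,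
    if_true, reduceCtorEq, if_false, Finset.sum_const_zero, add_zero, smul_smul, Finset.sum_ite_eq]
  congr 1
  · simp only [mul_comm]
  · simp only [Finset.smul_sum, Finset.sum_smul, smul_smul]
    rw [Finset.sum_comm]
    conv_rhs => rw [Finset.sum_comm]
    refine Finset.sum_congr rfl fun h _ => ?_
    conv_rhs => rw [← Equiv.sum_comp (Equiv.addLeft h)]
    simp [mul_comm]

lemma adV_inl (g : G) (a : ΩIdx G) (u : TYV G) :
    adV χ τ (Sum.inl (g, a)) u = ∑ b : ΩIdx G,
      circ χ τ (circ χ τ (basisV (Sum.inl (-g, shiftΩ G b g))) u) (basisV (Sum.inl (g, b))) := by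
  rw [adV_apply, Fintype.sum_sum_type, Fintype.sum_prod_type, Finset.sum_eq_single g]
  · simp [antiCoef, barV]
  · intro g' _ hg'
    simp [antiCoef, Ne.symm hg']
  · simp

lemma adV_inl_embV (g : G) (a : ΩIdx G) (f : (G → ℂ) × (G → ℂ)) :
    adV χ τ (Sum.inl (g, a)) (embV f) = embV (fun k => f.1 (k - g), f.2) := by
  rw [embV_eq_sum f, embV_eq_sum]
  simp only [map_add, map_sum, map_smul]
  congr 1
  · conv_rhs => rw [← Equiv.sum_comp (Equiv.addRight g)]
    refine Finset.sum_congr rfl fun k _ => ?_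
    simp only [Equiv.coe_addRight, add_sub_cancel_right]
    congr 1
    rw [adV_inl, Finset.sum_eq_single (Sum.inl (k + g))]
    · simp [shiftΩ, circ_inl_inl_inl, add_comm g k]
    · rintro (b | b) _ hb
      · have : k ≠ b - g := fun h => hb (by rw [h]; simp)
        simp [shiftΩ, circ_inl_inl_inl, this]
      · cases b
        simp [shiftΩ, circ_inl_inr_inl]
    · simp
  · refine Finset.sum_congr rfl fun k _ => ?_
    congr 1
    rw [adV_inl, Finset.sum_eq_single (Sum.inr ())]
    · simp [shiftΩ, circ_inl_inr_inl, add_comm (-g)]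
    · rintro (b | b) _ hb
      · simp [shiftΩ, circ_inl_inl_inl]
      · exact absurd rfl hb
    · simp

lemma adV_inr_inl (h : G) (u : TYV G) :
    adV χ τ (Sum.inr (Sum.inl h)) u =
      ∑ k, circ χ τ (circ χ τ (basisV (Sum.inr (Sum.inr k))) u) (basisV (Sum.inr (Sum.inl k))) +
      (τ : ℂ)⁻¹ • ∑ k, circ χ τ (circ χ τ (basisV (Sum.inr (Sum.inl k))) u)
        (basisV (Sum.inr (Sum.inr k))) := by
  rw [adV_apply, Fintype.sum_sum_type, Finset.sum_eq_zero, zero_add, Fintype.sum_sum_type,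
    Finset.smul_sum]
  · simp [antiCoef, barV]
  · rintro ⟨g, a⟩ _
    simp [antiCoef]

lemma adV_inr_inl_embV (h : G) (f : (G → ℂ) × (G → ℂ)) :
    adV χ τ (Sum.inr (Sum.inl h)) (embV f) =
      embV (fun k => (τ : ℂ)⁻¹ * ∑ l, f.2 l * χ l k, fun g => (τ : ℂ) * ∑ k, f.1 k * (χ g k)⁻¹) := by
  have h1 (k : G) : adV χ τ (Sum.inr (Sum.inl h)) (basisV (Sum.inl (0, Sum.inl k))) =
      embV (0, fun g => (τ : ℂ) * (χ g k)⁻¹) := by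
    simp only [adV_inr_inl, circ_inr_inl_inl, circ_inr_inr_inl, zero_add, Sum.inl.injEq,
      reduceCtorEq, if_false, map_zero, LinearMap.zero_apply, Finset.sum_const_zero, smul_zero,
      add_zero]
    rw [Finset.sum_eq_single k]
    · simp [circ_inr_inr_inr_inl]
    · intro b _ hb
      simp [Ne.symm hb]
    · simp
  have h2 (l : G) : adV χ τ (Sum.inr (Sum.inl h)) (basisV (Sum.inl (l, Sum.inr ()))) =
      embV (fun k => (τ : ℂ)⁻¹ * χ l k, 0) := by
    simp only [adV_inr_inl, circ_inr_inl_inl, circ_inr_inr_inl, reduceCtorEq, if_false, map_zero,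
      LinearMap.zero_apply, Finset.sum_const_zero, zero_add, if_true, map_smul,
      LinearMap.smul_apply, circ_inr_inl_inr_inr, sub_self]
    rw [embV_eq_sum]
    simp [Finset.smul_sum, smul_smul]
  rw [embV_eq_sum f]
  simp only [map_add, map_sum, map_smul, h1, h2]
  simp only [← map_smul, ← map_sum, ← map_add]
  congr 1
  ext k
  · simp [Prod.fst_sum, Finset.sum_apply, Finset.mul_sum, mul_left_comm]
  · simp [Prod.snd_sum, Finset.sum_apply, Finset.mul_sum, mul_left_comm]

lemma adV_inr_inr (hτ : τ ≠ 0) (h h' : G) (u : TYV G) :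
    adV χ τ (Sum.inr (Sum.inr h)) u = (τ : ℂ) • adV χ τ (Sum.inr (Sum.inl h')) u := by
  rw [adV_apply, adV_apply, Finset.smul_sum]
  refine Finset.sum_congr rfl fun γ _ => ?_
  rw [smul_smul]
  congr 1
  have : (τ : ℂ) ≠ 0 := by exact_mod_cast hτ
  rcases γ with γ | (γ | γ) <;> simp [antiCoef, this]

end Table

/-- The involution of `⊕_g H^g` inducing that of `B`. -/
def stV (u : TYV G) : TYV G
  | Sum.inl (g, a) => star (u (Sum.inl (-g, shiftΩ G a g)))
  | Sum.inr _ => 0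

lemma stV_embV (f : (G → ℂ) × (G → ℂ)) :
    stV (embV f) = embV (fun k => star (f.1 k), fun g => star (f.2 (-g))) := by
  ext c
  rcases c with ⟨g, a | a⟩ | a
  · by_cases h : g = 0 <;> simp [stV, embV_apply, shiftΩ, h]
  · simp [stV, embV_apply, shiftΩ]
  · rcases a with a | a <;> simp [stV, embV_apply]

lemma starTY_add (τ : ℝ) (a b : TYB G) : starTY G τ (a + b) = starTY G τ a + starTY G τ b := by
  ext r; simp [starTY, add_mul, Finset.sum_add_distrib]

lemma starTY_zero (τ : ℝ) : starTY G τ (0 : TYB G) = 0 := by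
  ext r; simp [starTY]

lemma starTY_tens (τ : ℝ) {g : G} {u : TYV G} (hu : IsHomog (Sum.inl g) u)
    (w : TYV G) : starTY G τ (tens u w) = tens (stV u) (stV w) := by
  have hu' : ∀ a, u (Sum.inr a) = 0 := fun a => hu _ (by simp [tyGrade])
  ext r
  obtain ⟨⟨r1, r2⟩, hr⟩ := r
  rcases r1 with ⟨g₁, a₁⟩ | r1
  · rcases r2 with ⟨g₂, a₂⟩ | r2
    · simp only [tyGrade, Sum.inl.injEq] at hr
      subst hr
      rw [starTY, Finset.sum_eq_single
        (⟨(Sum.inl (-g₁, shiftΩ G a₁ g₁), Sum.inl (-g₁, shiftΩ G a₂ g₁)), rfl⟩ : BIdx G)]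
      · rcases a₁ with a₁ | a₁ <;> rcases a₂ with a₂ | a₂ <;>
          simp [tens, stV, starCoef, shiftΩ]
      · rintro ⟨⟨p1, p2⟩, hp⟩ _ hne
        rcases p1 with ⟨h, b⟩ | p1
        · rcases p2 with ⟨h', b'⟩ | p2
          · simp only [tyGrade, Sum.inl.injEq] at hp
            subst hp
            rw [starCoef]
            simp only
            rw [if_neg, mul_zero]
            rintro ⟨rfl, -, rfl, rfl⟩
            apply hne
            rcases b with b | b <;> rcases b' with b' | b' <;> simp [shiftΩ]
          · simp [tyGrade] at hp
        · simp [tens, hu']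
      · simp
    · simp [tyGrade] at hr
  · rcases r2 with ⟨g₂, a₂⟩ | r2
    · simp [tyGrade] at hr
    · rw [starTY]
      refine (Finset.sum_eq_zero ?_).trans ?_
      · rintro ⟨⟨p1, p2⟩, hp⟩ _
        rcases p1 with ⟨h, b⟩ | p1
        · simp [starCoef]
        · simp [tens, hu']
      · simp [tens, stV]

/-- The vector `v^0_Ω`. -/
def vΩ : TYV G := embV (fun _ => 1, Pi.single 0 1)

lemma isHomog_vΩ : IsHomog (Sum.inl 0) (vΩ : TYV G) := by
  intro c hc
  rcases c with ⟨g, a | a⟩ | a <;> simp_all [vΩ, embV_apply, tyGrade]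

lemma oneTY_eq : oneTY G = tens vΩ vΩ := by
  ext ⟨⟨r1, r2⟩, hr⟩
  rcases r1 with ⟨g, a⟩ | r1
  · rcases r2 with ⟨g', b⟩ | r2
    · simp only [tyGrade, Sum.inl.injEq] at hr
      subst hr
      by_cases hg : g = 0 <;> rcases a with a | a <;> rcases b with b | b <;>
        simp [oneTY, tens, vΩ, embV_apply, hg]
    · simp [tyGrade] at hr
  · simp [oneTY, tens, vΩ, embV_apply]

lemma gradeProj_embV_zero (f : (G → ℂ) × (G → ℂ)) :
    gradeProj (Sum.inl 0) (embV f) = embV (f.1, Pi.single 0 (f.2 0)) := by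
  ext c
  rcases c with ⟨g, a | a⟩ | (a | a)
  · by_cases hg : g = 0 <;> simp [gradeProj_apply, embV_apply, tyGrade, hg]
  · by_cases hg : g = 0 <;> simp [gradeProj_apply, embV_apply, tyGrade, hg]
  · simp [gradeProj_apply, embV_apply, tyGrade]
  · simp [gradeProj_apply, embV_apply, tyGrade]

lemma gradeProj_embV_of_ne {g : G} (hg : g ≠ 0) (f : (G → ℂ) × (G → ℂ)) :
    gradeProj (Sum.inl g) (embV f) = embV (0, Pi.single g (f.2 g)) := by
  ext c
  rcases c with ⟨h, a | a⟩ | (a | a) <;> simp [gradeProj_apply, embV_apply, tyGrade]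
  · grind
  · by_cases h' : h = g <;> simp [h']

lemma gradeProj_embV_inr (f : (G → ℂ) × (G → ℂ)) :
    gradeProj (Sum.inr ()) (embV f) = 0 := by
  ext c
  rcases c with ⟨h, a | a⟩ | (a | a) <;> simp [gradeProj_apply, embV_apply, tyGrade]

/-- The elements of `B` all of whose columns belong to `W`. -/
def colSub (W : Submodule ℂ (TYV G)) : Submodule ℂ (TYB G) := ⨅ β, W.comap (colB β)

lemma mem_colSub {W : Submodule ℂ (TYV G)} {b : TYB G} : b ∈ colSub W ↔ ∀ β, colB β b ∈ W := by
  simp [colSub]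

lemma colSub_mono {W W' : Submodule ℂ (TYV G)} (h : W ≤ W') : colSub W ≤ colSub W' :=
  fun _ hb => mem_colSub.2 fun β => h (mem_colSub.1 hb β)

lemma colSub_inf (W W' : Submodule ℂ (TYV G)) : colSub (W ⊓ W') = colSub W ⊓ colSub W' := by
  ext b; simp [mem_colSub, forall_and]

lemma tens_mem_colSub {W : Submodule ℂ (TYV G)} (hW : ∀ x, ∀ u ∈ W, gradeProj x u ∈ W) {u : TYV G}
    (hu : u ∈ W) (w : TYV G) : tens u w ∈ colSub W :=
  mem_colSub.2 fun β => by rw [colB_tens]; exact W.smul_mem _ (hW _ _ hu)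

lemma ΔTY_apply (b : TYB G) (q r : BIdx G) :
    ΔTY G b (q, r) = tens (colB r.1.2 b) (basisV r.1.1) q := by
  by_cases h : q.1.2 = r.1.1
  · have hg : tyGrade G q.1.1 = tyGrade G r.1.2 := by rw [q.2, h, r.2]
    rw [ΔTY, Finset.sum_eq_single ⟨(q.1.1, r.1.2), hg⟩]
    · simp [Δc, tens, basisV_apply, h, colB_apply, hg]
    · rintro ⟨⟨p1, p2⟩, hp⟩ _ hne
      rw [Δc, if_neg, mul_zero]
      rintro ⟨h1, h2, -⟩
      apply hne
      exact Subtype.ext (Prod.ext h1.symm h2.symm)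
    · simp
  · simp [ΔTY, Δc, tens, basisV_apply, h]

lemma ΔTY_eq_sum (b : TYB G) :
    ΔTY G b = ∑ r : BIdx G, fun qr => tens (colB r.1.2 b) (basisV r.1.1) qr.1 *
      (Pi.single r 1 : TYB G) qr.2 := by
  ext ⟨q, r⟩
  rw [ΔTY_apply, Finset.sum_apply, Finset.sum_eq_single r]
  · simp
  · intro r' _ h
    simp [Ne.symm h]
  · simp

/-- The slices of the elements of a right coideal belong to it. -/
lemma tens_colB_mem {J : Submodule ℂ (TYB G)} {b : TYB G}
    (hb : ΔTY G b ∈ Submodule.span ℂ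
      {t : BIdx G × BIdx G → ℂ | ∃ u ∈ J, ∃ v : TYB G, t = fun qr => u qr.1 * v qr.2})
    (β γ : VIdx G) : tens (colB β b) (basisV γ) ∈ J := by
  by_cases h : tyGrade G γ = tyGrade G β
  · let T : (BIdx G × BIdx G → ℂ) →ₗ[ℂ] TYB G :=
      { toFun := fun t q => t (q, ⟨(γ, β), h⟩)
        map_add' := fun _ _ => rfl
        map_smul' := fun _ _ => rfl }
    have hle : Submodule.span ℂ
      {t : BIdx G × BIdx G → ℂ | ∃ u ∈ J, ∃ v : TYB G, t = fun qr => u qr.1 * v qr.2} ≤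
        J.comap T := by
      rw [Submodule.span_le]
      rintro t ⟨u, hu, v, rfl⟩
      have : T (fun qr => u qr.1 * v qr.2) = v ⟨(γ, β), h⟩ • u := by
        ext q; simp [T, mul_comm]
      rw [SetLike.mem_coe, Submodule.mem_comap, this]
      exact J.smul_mem _ hu
    have h2 := hle hb
    have : T (ΔTY G b) = tens (colB β b) (basisV γ) := by
      ext q; exact ΔTY_apply b q _
    rwa [Submodule.mem_comap, this] at h2
  · rw [tens_eq_zero (Ne.symm h) (isHomog_colB β b) (isHomog_basisV γ)]
    exact J.zero_mem

lemma isHomog_basisV_inl (g : G) (a : ΩIdx G) :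
    IsHomog (Sum.inl g) (basisV (Sum.inl (g, a)) : TYV G) :=
  isHomog_basisV (Sum.inl (g, a))

lemma colSub_induction {W : Submodule ℂ (TYV G)} (hE : W ≤ LinearMap.range embV)
    {P : TYB G → Prop} (h0 : P 0) (hadd : ∀ a b, P a → P b → P (a + b))
    (htens : ∀ g a u, u ∈ W → IsHomog (Sum.inl g) u → P (tens u (basisV (Sum.inl (g, a)))))
    {b : TYB G} (hb : b ∈ colSub W) : P b := by
  rw [sum_tens_colB b]
  refine Finset.sum_induction _ P hadd h0 fun β _ => ?_
  rcases β with ⟨g, a⟩ | β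
  · exact htens g a _ (mem_colSub.1 hb _) (isHomog_colB (Sum.inl (g, a)) b)
  · obtain ⟨f, hf⟩ := hE (mem_colSub.1 hb (Sum.inr β))
    have h := (isHomog_colB (Sum.inr β) b).gradeProj_eq
    rw [← hf] at h ⊢
    rw [← h, tyGrade, gradeProj_embV_inr, tens_zero_left]
    exact h0

lemma isCoidealTY_colSub {χ : G → G → ℂ} {τ : ℝ} {W : Submodule ℂ (TYV G)}
    (hE : W ≤ LinearMap.range embV) (hg : ∀ x, ∀ u ∈ W, gradeProj x u ∈ W) (hΩ : vΩ ∈ W)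
    (hc : ∀ u ∈ W, ∀ v ∈ W, circ χ τ u v ∈ W) (hs : ∀ u ∈ W, stV u ∈ W) :
    IsCoidealTY G χ τ (colSub W) := by
  refine ⟨?_, fun a ha b hb => ?_, fun a ha => ?_, fun a ha => ?_⟩
  · rw [oneTY_eq]
    exact tens_mem_colSub hg hΩ _
  · rw [← mulB_apply]
    refine colSub_induction (P := fun a => mulB χ τ a b ∈ colSub W) hE ?_ ?_ ?_ ha
    · simp
    · intro a a' h h'
      rw [map_add]
      exact add_mem h h'
    intro g x u hu hug
    refine colSub_induction (P := fun b => mulB χ τ (tens u _) b ∈ colSub W) hE ?_ ?_ ?_ hb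
    · simp
    · intro b b' h h'
      rw [map_add]
      exact add_mem h h'
    intro g' x' u' hu' hug'
    rw [mulB_apply, mulTY_tens χ τ hug (isHomog_basisV_inl g x) hug' (isHomog_basisV_inl g' x')]
    exact tens_mem_colSub hg (hc _ hu _ hu') _
  · refine colSub_induction (P := fun a => starTY G τ a ∈ colSub W) hE ?_ ?_ ?_ ha
    · rw [starTY_zero]
      exact zero_mem _
    · intro a a' h h'
      rw [starTY_add]
      exact add_mem h h'
    intro g x u hu hug
    rw [starTY_tens τ hug]
    exact tens_mem_colSub hg (hs _ hu) _
  · rw [ΔTY_eq_sum]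
    exact sum_mem fun r _ => Submodule.subset_span
      ⟨_, tens_mem_colSub hg (mem_colSub.1 ha _) _, _, rfl⟩

lemma isInvariantTY_colSub {χ : G → G → ℂ} {τ : ℝ} {W : Submodule ℂ (TYV G)}
    (hE : W ≤ LinearMap.range embV) (hg : ∀ x, ∀ u ∈ W, gradeProj x u ∈ W)
    (ha : ∀ α, ∀ u ∈ W, adV χ τ α u ∈ W) : IsInvariantTY G χ τ (colSub W) := by
  refine le_antisymm (Submodule.span_le.2 ?_) fun b hb => ?_
  · rintro y ⟨a, haW, x, rfl⟩
    rw [SetLike.mem_coe, adTY_eq_sum]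
    refine sum_mem fun p _ => Submodule.smul_mem _ _ ?_
    refine colSub_induction (P := fun a => adTY G χ τ a (Pi.single p 1) ∈ colSub W) hE ?_ ?_ ?_ haW
    · rw [adTY_zero]
      exact zero_mem _
    · intro a a' h h'
      rw [adTY_add]
      exact add_mem h h'
    intro g c u hu hug
    rw [adTY_tens χ τ hug (isHomog_basisV_inl g c)]
    exact tens_mem_colSub hg (ha _ _ hu) _
  · refine colSub_induction (P := fun b => b ∈ Submodule.span ℂ _) hE (zero_mem _)
      (fun _ _ => add_mem) ?_ hb
    intro g c u hu hug
    refine Submodule.subset_span ⟨_, tens_mem_colSub hg hu (basisV (Sum.inl (g, c))),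
      Pi.single ⟨(Sum.inl (0, shiftΩ G c g), Sum.inl (0, c)), rfl⟩ 1, ?_⟩
    rw [adTY_tens χ τ hug (isHomog_basisV_inl g c)]
    obtain ⟨f, rfl⟩ := hE hu
    rw [adV_inl_embV]
    congr 1
    · simp
    · rcases c with c | c
      · simp [barV, shiftΩ, circ_inl_inl_inl]
      · cases c
        simp [barV, shiftΩ, circ_inl_inr_inl]

/-- A right coideal is determined by the span of its columns. -/
lemma eq_colSub_of_isCoidealTY {χ : G → G → ℂ} {τ : ℝ} {J : Submodule ℂ (TYB G)}
    (hJ : IsCoidealTY G χ τ J) {W : Submodule ℂ (TYV G)}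
    (hW : ∀ u, u ∈ W ↔ ∀ β, tens u (basisV β) ∈ J) : J = colSub W := by
  ext b
  rw [mem_colSub]
  constructor
  · intro hb β
    exact (hW _).2 fun γ => tens_colB_mem (hJ.2.2.2 b hb) β γ
  · intro hb
    rw [sum_tens_colB b]
    exact sum_mem fun β _ => (hW _).1 (hb β) β

section Bicharacter

/-- `χ` is a nondegenerate symmetric bicharacter with values in the unit circle. -/
structure IsNondegBichar (χ : G → G → ℂ) : Prop where
  symm : ∀ g h, χ g h = χ h g
  add_left : ∀ g g' h, χ (g + g') h = χ g h * χ g' h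
  norm : ∀ g h, ‖χ g h‖ = 1
  nondeg : ∀ g, (∀ h, χ g h = 1) → g = 0

namespace IsNondegBichar

variable {χ : G → G → ℂ}

lemma ne_zero (hχ : IsNondegBichar χ) (g h : G) : χ g h ≠ 0 := by
  intro h0
  have := hχ.norm g h
  simp [h0] at this

lemma zero_left (hχ : IsNondegBichar χ) (h : G) : χ 0 h = 1 := by
  have := hχ.add_left 0 0 h
  rw [add_zero] at this
  exact (mul_eq_left₀ (hχ.ne_zero 0 h)).1 this.symm

lemma add_right (hχ : IsNondegBichar χ) (g h h' : G) : χ g (h + h') = χ g h * χ g h' := by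
  rw [hχ.symm, hχ.add_left, hχ.symm h, hχ.symm h']

lemma neg_left (hχ : IsNondegBichar χ) (g h : G) : χ (-g) h = (χ g h)⁻¹ := by
  refine eq_inv_of_mul_eq_one_left ?_
  rw [← hχ.add_left, neg_add_cancel, hχ.zero_left]

/-- If `φ` is invariant under a translation on which `χ g` is nontrivial, then the Fourier
coefficient of `φ` at `g` vanishes. -/
lemma sum_mul_eq_zero (hχ : IsNondegBichar χ) {φ : G → ℂ} {g x : G}
    (hφ : ∀ k, φ (k + x) = φ k) (hx : χ g x ≠ 1) : ∑ k, φ k * χ g k = 0 := by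
  have h : ∑ k, φ k * χ g k = χ g x * ∑ k, φ k * χ g k := by
    conv_lhs => rw [← Equiv.sum_comp (Equiv.addRight x)]
    rw [Finset.mul_sum]
    refine Finset.sum_congr rfl fun k _ => ?_
    rw [Equiv.coe_addRight, hφ, hχ.add_right]
    ring
  by_contra h0
  exact hx ((mul_eq_right₀ h0).1 h.symm)

lemma sum_mul_inv_eq_zero (hχ : IsNondegBichar χ) {φ : G → ℂ} {g x : G}
    (hφ : ∀ k, φ (k + x) = φ k) (hx : χ g x ≠ 1) : ∑ k, φ k * (χ g k)⁻¹ = 0 := by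
  simp only [← hχ.neg_left]
  refine hχ.sum_mul_eq_zero hφ ?_
  rwa [hχ.neg_left, ne_eq, inv_eq_one]

lemma sum_right (hχ : IsNondegBichar χ) (g : G) :
    ∑ k, χ g k = if g = 0 then (Fintype.card G : ℂ) else 0 := by
  split_ifs with h
  · simp [h, hχ.zero_left]
  · obtain ⟨x, hx⟩ : ∃ x, χ g x ≠ 1 := by
      by_contra! h'
      exact h (hχ.nondeg g h')
    simpa using hχ.sum_mul_eq_zero (φ := fun _ => 1) (fun _ => rfl) hx

lemma sum_inv_right (hχ : IsNondegBichar χ) (g : G) :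
    ∑ k, (χ g k)⁻¹ = if g = 0 then (Fintype.card G : ℂ) else 0 := by
  simp only [← hχ.neg_left, hχ.sum_right, neg_eq_zero]

/-- Fourier inversion. -/
lemma fourier_inversion (hχ : IsNondegBichar χ) (φ : G → ℂ) (x : G) :
    ∑ g, (∑ k, φ k * (χ g k)⁻¹) * χ g x = Fintype.card G * φ x := by
  simp only [Finset.sum_mul]
  rw [Finset.sum_comm, Finset.sum_eq_single x]
  · simp [hχ.ne_zero, mul_comm]
  · intro k _ hk
    have h := hχ.sum_right (x - k)
    rw [if_neg (sub_ne_zero.2 hk.symm)] at h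
    calc ∑ g, φ k * (χ g k)⁻¹ * χ g x = ∑ g, φ k * χ (x - k) g := by
          refine Finset.sum_congr rfl fun g _ => ?_
          rw [sub_eq_add_neg, hχ.add_left, hχ.neg_left, hχ.symm g k, hχ.symm g x]
          ring
      _ = 0 := by rw [← Finset.mul_sum, h, mul_zero]
  · simp

/-- The annihilator of a subset, as a subgroup. -/
def perp (hχ : IsNondegBichar χ) (L : AddSubgroup G) : AddSubgroup G where
  carrier := Lperp G χ L
  zero_mem' l _ := hχ.zero_left l
  add_mem' ha hb l hl := by rw [hχ.add_left, ha l hl, hb l hl, one_mul]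
  neg_mem' ha l hl := by rw [hχ.neg_left, ha l hl, inv_one]

lemma mem_perp (hχ : IsNondegBichar χ) {L : AddSubgroup G} {g : G} :
    g ∈ hχ.perp L ↔ ∀ l ∈ L, χ g l = 1 := Iff.rfl

lemma exists_of_notMem_perp (hχ : IsNondegBichar χ) {L : AddSubgroup G} {g : G}
    (hg : g ∉ hχ.perp L) : ∃ l ∈ L, χ g l ≠ 1 := by
  simpa [mem_perp] using hg

/-- A function whose Fourier transform is supported on `M` is `M^⊥`-invariant. -/
lemma apply_add_of_fourier (hχ : IsNondegBichar χ) {φ : G → ℂ} {l : G}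
    (h : ∀ g, χ g l ≠ 1 → ∑ k, φ k * (χ g k)⁻¹ = 0) (x : G) : φ (x + l) = φ x := by
  have hc : (Fintype.card G : ℂ) ≠ 0 := by
    have := Fintype.card_pos (α := G)
    exact_mod_cast this.ne'
  refine mul_left_cancel₀ hc ?_
  rw [← hχ.fourier_inversion, ← hχ.fourier_inversion]
  refine Finset.sum_congr rfl fun g _ => ?_
  by_cases hg : χ g l = 1
  · rw [hχ.add_right, hg, mul_one]
  · rw [h g hg, zero_mul, zero_mul]

lemma perp_perp (hχ : IsNondegBichar χ) (L : AddSubgroup G) : hχ.perp (hχ.perp L) = L := by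
  refine le_antisymm (fun x hx => ?_) fun x hx g hg => by rw [hχ.symm]; exact hg x hx
  have h := hχ.apply_add_of_fourier (φ := fun k => if k ∈ L then (1 : ℂ) else 0) (l := x) ?_ 0
  · by_contra hxL
    simp [hxL] at h
  · intro g hg
    have hgL : g ∉ hχ.perp L := fun hgL => hg (by rw [hχ.symm]; exact hx g hgL)
    obtain ⟨l, hl, hgl⟩ := hχ.exists_of_notMem_perp hgL
    exact hχ.sum_mul_inv_eq_zero (fun k => by simp [L.add_mem_cancel_right hl]) hgl

lemma perp_anti (hχ : IsNondegBichar χ) {L K : AddSubgroup G} (h : L ≤ K) :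
    hχ.perp K ≤ hχ.perp L :=
  fun _ hg l hl => hg l (h hl)

lemma perp_inf (hχ : IsNondegBichar χ) (L K : AddSubgroup G) :
    hχ.perp (L ⊓ K) = hχ.perp L ⊔ hχ.perp K := by
  refine le_antisymm ?_ (sup_le (hχ.perp_anti inf_le_left) (hχ.perp_anti inf_le_right))
  rw [← hχ.perp_perp (hχ.perp L ⊔ hχ.perp K)]
  refine hχ.perp_anti (le_inf ?_ ?_)
  · exact (hχ.perp_anti le_sup_left).trans (hχ.perp_perp L).le
  · exact (hχ.perp_anti le_sup_right).trans (hχ.perp_perp K).le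

lemma perp_sup (hχ : IsNondegBichar χ) (L K : AddSubgroup G) :
    hχ.perp (L ⊔ K) = hχ.perp L ⊓ hχ.perp K := by
  rw [← hχ.perp_perp (hχ.perp L ⊓ hχ.perp K), hχ.perp_inf, hχ.perp_perp, hχ.perp_perp]

end IsNondegBichar

lemma tau_facts {τ : ℝ}
    (hτ : τ = (Real.sqrt (Fintype.card G))⁻¹ ∨ τ = -(Real.sqrt (Fintype.card G))⁻¹) :
    τ ≠ 0 ∧ (τ : ℂ) * Fintype.card G = (τ : ℂ)⁻¹ := by
  have hc : (0 : ℝ) < Fintype.card G := by exact_mod_cast Fintype.card_pos (α := G)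
  have hs := Real.sqrt_pos.2 hc
  have hsq : τ * τ * Fintype.card G = 1 := by
    have h : τ * τ = (Real.sqrt (Fintype.card G) * Real.sqrt (Fintype.card G))⁻¹ := by
      rw [mul_inv]
      rcases hτ with rfl | rfl <;> ring
    rw [h, Real.mul_self_sqrt hc.le, inv_mul_cancel₀ hc.ne']
  have h0 : τ ≠ 0 := by
    rintro rfl
    simp at hsq
  refine ⟨h0, eq_inv_of_mul_eq_one_left ?_⟩
  have : (τ : ℂ) * τ * Fintype.card G = 1 := by exact_mod_cast hsq
  linear_combination this

end Bicharacter

/-- The span of the columns of `I^L`, where `M = L^⊥`. -/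
def latV (L M : AddSubgroup G) : Submodule ℂ (TYV G) :=
  Submodule.map embV
    { carrier := {f | (∀ k, ∀ l ∈ L, f.1 (k + l) = f.1 k) ∧ ∀ g, g ∉ M → f.2 g = 0}
      zero_mem' := by simp
      add_mem' := by
        rintro f f' ⟨h1, h2⟩ ⟨h1', h2'⟩
        exact ⟨fun k l hl => by simp [h1 k l hl, h1' k l hl],
          fun g hg => by simp [h2 g hg, h2' g hg]⟩
      smul_mem' := by
        rintro c f ⟨h1, h2⟩
        exact ⟨fun k l hl => by simp [h1 k l hl], fun g hg => by simp [h2 g hg]⟩ }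

lemma embV_mem_latV {L M : AddSubgroup G} {f : (G → ℂ) × (G → ℂ)} :
    embV f ∈ latV L M ↔
      (∀ k, ∀ l ∈ L, f.1 (k + l) = f.1 k) ∧ ∀ g, g ∉ M → f.2 g = 0 := by
  constructor
  · rintro ⟨f', h, h'⟩
    rw [← embV_injective h']
    exact h
  · exact fun h => ⟨f, h, rfl⟩

lemma exists_of_mem_latV {L M : AddSubgroup G} {u : TYV G} (hu : u ∈ latV L M) :
    ∃ f : (G → ℂ) × (G → ℂ), u = embV f ∧
      (∀ k, ∀ l ∈ L, f.1 (k + l) = f.1 k) ∧ ∀ g, g ∉ M → f.2 g = 0 := by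
  obtain ⟨f, h, rfl⟩ := hu
  exact ⟨f, rfl, h⟩

lemma latV_le_range (L M : AddSubgroup G) : latV L M ≤ LinearMap.range embV := by
  rintro _ ⟨f, -, rfl⟩
  exact ⟨f, rfl⟩

lemma vΩ_mem_latV (L M : AddSubgroup G) : vΩ ∈ latV L M := by
  refine embV_mem_latV.2 ⟨fun _ _ _ => rfl, fun g hg => ?_⟩
  have : g ≠ 0 := by
    rintro rfl
    exact hg M.zero_mem
  simp [this]

lemma gradeProj_mem_latV {L M : AddSubgroup G} (x : ΩIdx G) {u : TYV G} (hu : u ∈ latV L M) :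
    gradeProj x u ∈ latV L M := by
  obtain ⟨f, rfl, h1, h2⟩ := exists_of_mem_latV hu
  rcases x with g | x
  · by_cases hg : g = 0
    · subst hg
      rw [gradeProj_embV_zero]
      refine embV_mem_latV.2 ⟨h1, fun g hg => ?_⟩
      by_cases h0 : g = 0
      · subst h0
        simp [h2 0 hg]
      · simp [h0]
    · rw [gradeProj_embV_of_ne hg]
      refine embV_mem_latV.2 ⟨fun _ _ _ => rfl, fun g' hg' => ?_⟩
      by_cases h0 : g' = g
      · subst h0
        simp [h2 g' hg']
      · simp [h0]
  · cases x
    rw [gradeProj_embV_inr]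
    exact zero_mem _

lemma circ_mem_latV (χ : G → G → ℂ) (τ : ℝ) {L M : AddSubgroup G} {u v : TYV G}
    (hu : u ∈ latV L M) (hv : v ∈ latV L M) : circ χ τ u v ∈ latV L M := by
  obtain ⟨f, rfl, h1, h2⟩ := exists_of_mem_latV hu
  obtain ⟨f', rfl, h1', h2'⟩ := exists_of_mem_latV hv
  rw [circ_embV]
  refine embV_mem_latV.2 ⟨fun k l hl => ?_, fun g hg => ?_⟩
  · simp only [h1 k l hl, h1' k l hl]
  · refine Finset.sum_eq_zero fun h _ => ?_
    by_cases hh : h ∈ M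
    · have : g - h ∉ M := fun hgh => hg (by simpa using M.add_mem hgh hh)
      rw [h2' _ this, mul_zero]
    · rw [h2 h hh, zero_mul]

lemma stV_mem_latV {L M : AddSubgroup G} {u : TYV G} (hu : u ∈ latV L M) : stV u ∈ latV L M := by
  obtain ⟨f, rfl, h1, h2⟩ := exists_of_mem_latV hu
  rw [stV_embV]
  refine embV_mem_latV.2 ⟨fun k l hl => ?_, fun g hg => ?_⟩
  · simp only [h1 k l hl]
  · simp only [h2 (-g) (by simpa using hg), star_zero]

lemma adV_mem_latV {χ : G → G → ℂ} (hχ : IsNondegBichar χ) {τ : ℝ} (hτ : τ ≠ 0)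
    {L : AddSubgroup G} (α : VIdx G) {u : TYV G} (hu : u ∈ latV L (hχ.perp L)) :
    adV χ τ α u ∈ latV L (hχ.perp L) := by
  obtain ⟨f, rfl, h1, h2⟩ := exists_of_mem_latV hu
  have key (h : G) : adV χ τ (Sum.inr (Sum.inl h)) (embV f) ∈ latV L (hχ.perp L) := by
    rw [adV_inr_inl_embV]
    refine embV_mem_latV.2 ⟨fun k l hl => ?_, fun g hg => ?_⟩
    · simp only
      congr 1
      refine Finset.sum_congr rfl fun g _ => ?_
      by_cases hg : g ∈ hχ.perp L
      · rw [hχ.add_right, hχ.mem_perp.1 hg l hl, mul_one]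
      · rw [h2 g hg, zero_mul, zero_mul]
    · obtain ⟨l, hl, hgl⟩ := hχ.exists_of_notMem_perp hg
      simp only
      rw [hχ.sum_mul_inv_eq_zero (fun k => h1 k l hl) hgl, mul_zero]
  rcases α with ⟨g, a⟩ | (h | h)
  · rw [adV_inl_embV]
    refine embV_mem_latV.2 ⟨fun k l hl => ?_, h2⟩
    simp only
    rw [add_sub_right_comm, h1 _ l hl]
  · exact key h
  · rw [adV_inr_inr χ τ hτ h 0]
    exact Submodule.smul_mem _ _ (key 0)

lemma circ_vΩ (χ : G → G → ℂ) (τ : ℝ) : circ χ τ vΩ vΩ = (vΩ : TYV G) := by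
  rw [vΩ, circ_embV]
  congr 1
  ext g
  · simp
  · simp only
    rw [Finset.sum_eq_single 0]
    · simp
    · intro h _ hh
      simp [hh]
    · simp

lemma stV_vΩ : stV vΩ = (vΩ : TYV G) := by
  rw [vΩ, stV_embV]
  congr 1
  ext g
  · simp
  · by_cases hg : g = 0 <;> simp [hg]

lemma stV_smul (c : ℂ) (u : TYV G) : stV (c • u) = star c • stV u := by
  ext a
  rcases a with a | a <;> simp [stV]

lemma gradeProj_vΩ_of_ne {x : ΩIdx G} (hx : x ≠ Sum.inl 0) :
    gradeProj x (vΩ : TYV G) = 0 := by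
  ext c
  rw [gradeProj_apply]
  split_ifs with h
  · exact isHomog_vΩ c (h ▸ hx)
  · rfl

lemma adV_vΩ {χ : G → G → ℂ} (hχ : IsNondegBichar χ) {τ : ℝ} (hτ : τ ≠ 0)
    (hτG : (τ : ℂ) * Fintype.card G = (τ : ℂ)⁻¹) (α : VIdx G) :
    adV χ τ α vΩ ∈ Submodule.span ℂ {(vΩ : TYV G)} := by
  have key (h : G) : adV χ τ (Sum.inr (Sum.inl h)) vΩ = (τ : ℂ)⁻¹ • (vΩ : TYV G) := by
    rw [vΩ, adV_inr_inl_embV, ← map_smul]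
    congr 1
    ext g
    · simp [Pi.single_apply, hχ.zero_left]
    · simp [hχ.sum_inv_right, Pi.single_apply, hτG]
  rcases α with ⟨g, a⟩ | (h | h)
  · rw [vΩ, adV_inl_embV]
    exact Submodule.mem_span_singleton_self _
  · rw [key]
    exact Submodule.smul_mem _ _ (Submodule.mem_span_singleton_self _)
  · rw [adV_inr_inr χ τ hτ h 0, key]
    exact Submodule.smul_mem _ _ (Submodule.smul_mem _ _ (Submodule.mem_span_singleton_self _))

lemma isCoidealTY_colSub_latV {χ : G → G → ℂ} (hχ : IsNondegBichar χ) (τ : ℝ)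
    (L : AddSubgroup G) : IsCoidealTY G χ τ (colSub (latV L (hχ.perp L))) :=
  isCoidealTY_colSub (latV_le_range _ _) (fun _ _ => gradeProj_mem_latV _) (vΩ_mem_latV _ _)
    (fun _ hu _ hv => circ_mem_latV χ τ hu hv) (fun _ => stV_mem_latV)

lemma isInvariantTY_colSub_latV {χ : G → G → ℂ} (hχ : IsNondegBichar χ) {τ : ℝ} (hτ : τ ≠ 0)
    (L : AddSubgroup G) : IsInvariantTY G χ τ (colSub (latV L (hχ.perp L))) :=
  isInvariantTY_colSub (latV_le_range _ _) (fun _ _ => gradeProj_mem_latV _)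
    (fun _ _ => adV_mem_latV hχ hτ _)

lemma spanVΩ_le_range : Submodule.span ℂ {(vΩ : TYV G)} ≤ LinearMap.range embV := by
  rw [Submodule.span_singleton_le_iff_mem]
  exact ⟨_, rfl⟩

lemma gradeProj_mem_spanVΩ (x : ΩIdx G) {u : TYV G} (hu : u ∈ Submodule.span ℂ {(vΩ : TYV G)}) :
    gradeProj x u ∈ Submodule.span ℂ {(vΩ : TYV G)} := by
  obtain ⟨c, rfl⟩ := Submodule.mem_span_singleton.1 hu
  by_cases hx : x = Sum.inl 0
  · rw [map_smul, hx, isHomog_vΩ.gradeProj_eq]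
    exact hu
  · rw [map_smul, gradeProj_vΩ_of_ne hx, smul_zero]
    exact zero_mem _

lemma isCoidealTY_colSub_spanVΩ (χ : G → G → ℂ) (τ : ℝ) :
    IsCoidealTY G χ τ (colSub (Submodule.span ℂ {vΩ})) := by
  refine isCoidealTY_colSub spanVΩ_le_range (fun _ _ => gradeProj_mem_spanVΩ _)
    (Submodule.mem_span_singleton_self _) (fun u hu v hv => ?_) (fun u hu => ?_)
  · obtain ⟨c, rfl⟩ := Submodule.mem_span_singleton.1 hu
    obtain ⟨d, rfl⟩ := Submodule.mem_span_singleton.1 hv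
    rw [map_smul, map_smul, LinearMap.smul_apply, circ_vΩ]
    exact Submodule.smul_mem _ _ (Submodule.smul_mem _ _ (Submodule.mem_span_singleton_self _))
  · obtain ⟨c, rfl⟩ := Submodule.mem_span_singleton.1 hu
    rw [stV_smul, stV_vΩ]
    exact Submodule.smul_mem _ _ (Submodule.mem_span_singleton_self _)

lemma isInvariantTY_colSub_spanVΩ {χ : G → G → ℂ} (hχ : IsNondegBichar χ) {τ : ℝ} (hτ : τ ≠ 0)
    (hτG : (τ : ℂ) * Fintype.card G = (τ : ℂ)⁻¹) :
    IsInvariantTY G χ τ (colSub (Submodule.span ℂ {vΩ})) := by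
  refine isInvariantTY_colSub spanVΩ_le_range (fun _ _ => gradeProj_mem_spanVΩ _)
    (fun α u hu => ?_)
  obtain ⟨c, rfl⟩ := Submodule.mem_span_singleton.1 hu
  rw [map_smul]
  exact Submodule.smul_mem _ _ (adV_vΩ hχ hτ hτG α)

lemma isHomog_embV_zero (φ : G → ℂ) : IsHomog (Sum.inl 0) (embV (φ, 0)) := by
  intro c hc
  rcases c with ⟨g, a | a⟩ | a <;> simp_all [embV_apply, tyGrade]

lemma bCoset_eq (Y : Set G) (w : ΩIdx G) :
    bCoset G Y w = tens (embV (fun y => if y ∈ Y then 1 else 0, 0)) (basisV (Sum.inl (0, w))) := by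
  ext ⟨⟨r1, r2⟩, hr⟩
  rcases r1 with ⟨g, a | a⟩ | r1
  · rcases r2 with ⟨g', b⟩ | r2
    · simp only [tyGrade, Sum.inl.injEq] at hr
      subst hr
      by_cases hg : g = 0 <;> by_cases ha : a ∈ Y <;> by_cases hb : b = w <;>
        simp [bCoset, tens, embV_apply, basisV_apply, hg, ha, hb]
    · simp [tyGrade] at hr
  · simp [bCoset, tens, embV_apply]
  · simp [bCoset, tens, embV_apply]

lemma bM_eq (l : G) (w : ΩIdx G) :
    bM G l w = tens (basisV (Sum.inl (l, Sum.inr ()))) (basisV (Sum.inl (l, w))) := by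
  ext ⟨⟨r1, r2⟩, hr⟩
  rcases r1 with ⟨g, a | a⟩ | r1
  · simp [bM, tens, basisV_apply]
  · rcases r2 with ⟨g', b⟩ | r2
    · simp only [tyGrade, Sum.inl.injEq] at hr
      subst hr
      by_cases hg : g = l <;> by_cases hb : b = w <;>
        simp [bM, tens, basisV_apply, hg, hb]
    · simp [tyGrade] at hr
  · simp [bM, tens, basisV_apply]

lemma basisV_eq_embV (l : G) :
    basisV (Sum.inl (l, Sum.inr ())) = embV (0, Pi.single l 1) := by
  ext c
  rcases c with ⟨g, a | a⟩ | a <;> simp [basisV_apply, embV_apply, Pi.single_apply]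

lemma eq_sum_coset_indicator (L : AddSubgroup G) {φ : G → ℂ} (hφ : ∀ k, ∀ l ∈ L, φ (k + l) = φ k) :
    φ = ∑ g, ((∑ l : G, if l ∈ L then (1 : ℂ) else 0)⁻¹ * φ g) •
      fun x => if x - g ∈ L then (1 : ℂ) else 0 := by
  have hN : (∑ l : G, if l ∈ L then (1 : ℂ) else 0) ≠ 0 := by
    rw [Finset.sum_boole]
    exact_mod_cast (Finset.card_pos.2 ⟨0, by simp⟩).ne'
  ext x
  simp only [Finset.sum_apply, Pi.smul_apply, smul_eq_mul, mul_assoc]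
  rw [← Finset.mul_sum]
  have : ∑ g, φ g * (if x - g ∈ L then (1 : ℂ) else 0) =
      (∑ l : G, if l ∈ L then (1 : ℂ) else 0) * φ x := by
    rw [← Equiv.sum_comp (Equiv.subLeft x), Finset.sum_mul]
    refine Finset.sum_congr rfl fun l _ => ?_
    simp only [Equiv.subLeft_apply, sub_sub_cancel]
    split_ifs with hl
    · rw [sub_eq_add_neg, hφ x _ (L.neg_mem hl), mul_one, one_mul]
    · simp
  rw [this, inv_mul_cancel_left₀ hN]

lemma ILTY_eq {χ : G → G → ℂ} (hχ : IsNondegBichar χ) (L : AddSubgroup G) :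
    ILTY G χ L = colSub (latV L (hχ.perp L)) := by
  refine le_antisymm (Submodule.span_le.2 ?_) fun b hb => ?_
  · rintro b (⟨g, w, rfl⟩ | ⟨l, hl, w, rfl⟩)
    · rw [bCoset_eq]
      refine tens_mem_colSub (fun _ _ => gradeProj_mem_latV _) (embV_mem_latV.2 ⟨?_, ?_⟩) _
      · intro k l hl
        simp [add_sub_right_comm, L.add_mem_cancel_right hl]
      · simp
    · rw [bM_eq, basisV_eq_embV]
      refine tens_mem_colSub (fun _ _ => gradeProj_mem_latV _) (embV_mem_latV.2 ⟨?_, ?_⟩) _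
      · simp
      · intro g hg
        have : g ≠ l := by
          rintro rfl
          exact hg hl
        simp [this]
  · refine colSub_induction (P := fun b => b ∈ ILTY G χ L) (latV_le_range _ _) (zero_mem _)
      (fun _ _ => add_mem) ?_ hb
    intro g a u hu _
    obtain ⟨f, rfl, h1, h2⟩ := exists_of_mem_latV hu
    have hf : embV f = embV (f.1, 0) + ∑ g, f.2 g • basisV (Sum.inl (g, Sum.inr ())) := by
      rw [embV_eq_sum f, embV_eq_sum (f.1, 0)]
      simp
    rw [hf, tens_add_left, tens_sum_left]
    refine add_mem ?_ (sum_mem fun l _ => ?_)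
    · by_cases hg : g = 0
      · subst hg
        have hf1 : (f.1, (0 : G → ℂ)) = LinearMap.inl ℂ _ _ f.1 := rfl
        rw [hf1, eq_sum_coset_indicator L h1]
        simp only [map_sum, map_smul]
        rw [tens_sum_left]
        refine sum_mem fun g _ => ?_
        rw [tens_smul_left]
        refine Submodule.smul_mem _ _ (Submodule.subset_span (Or.inl ⟨g, a, ?_⟩))
        rw [bCoset_eq]
        rfl
      · rw [tens_eq_zero (x := Sum.inl 0) (y := Sum.inl g) (by simpa using Ne.symm hg)
          (isHomog_embV_zero _) (isHomog_basisV_inl g a)]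
        exact zero_mem _
    · rw [tens_smul_left]
      by_cases hg : l = g
      · subst hg
        by_cases hl : l ∈ hχ.perp L
        · refine Submodule.smul_mem _ _ (Submodule.subset_span (Or.inr ⟨l, hl, a, ?_⟩))
          rw [bM_eq]
        · rw [h2 l hl, zero_smul]
          exact zero_mem _
      · rw [tens_eq_zero (x := Sum.inl l) (y := Sum.inl g) (by simpa using hg)
          (isHomog_basisV_inl l _) (isHomog_basisV_inl g a), smul_zero]
        exact zero_mem _

lemma εsTY_eq_sum (χ : G → G → ℂ) (τ : ℝ) (b : TYB G) :
    εsTY G χ τ b = ∑ r : BIdx G, εTY G (mulTY G χ τ b (Pi.single r 1)) •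
      tens (colB r.1.2 (oneTY G)) (basisV r.1.1) := by
  ext s
  simp only [εsTY, ΔTY_apply, Finset.sum_apply, Pi.smul_apply, smul_eq_mul, mul_comm]

lemma circ_basisV_zero (χ : G → G → ℂ) (τ : ℝ) (a x : ΩIdx G) :
    circ χ τ (basisV (Sum.inl (0, a))) (basisV (Sum.inl (0, x))) =
      if x = a then basisV (Sum.inl (0, a)) else 0 := by
  rcases a with a | a
  · simp [circ_inl_inl_inl]
  · cases a
    simp [circ_inl_inr_inl]

lemma εTY_tens (u w : TYV G) : εTY G (tens u w) = ∑ α, u α * star (w α) := by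
  have h := sum_BIdx (G := G) (fun α β => u α * star (w β) * if α = β then 1 else 0) ?_
  · simp only [εTY, tens]
    rw [h]
    simp
  · intro α β hαβ
    have : α ≠ β := by
      rintro rfl
      exact hαβ rfl
    simp [this]

lemma εsTY_single (χ : G → G → ℂ) (τ : ℝ) (a : ΩIdx G) :
    εsTY G χ τ (Pi.single ⟨(Sum.inl (0, a), Sum.inl (0, a)), rfl⟩ 1) =
      tens vΩ (basisV (Sum.inl (0, a))) := by
  have hcol (β : VIdx G) : colB β (oneTY G) = star (vΩ β) • gradeProj (tyGrade G β) vΩ := by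
    rw [oneTY_eq, colB_tens]
  have hvΩ (x : ΩIdx G) : (vΩ : TYV G) (Sum.inl (0, x)) = 1 := by
    rcases x with x | x <;> simp [vΩ, embV_apply]
  have hvΩ' {h : G} (hh : h ≠ 0) (x : ΩIdx G) : (vΩ : TYV G) (Sum.inl (h, x)) = 0 := by
    rcases x with x | x <;> simp [vΩ, embV_apply, hh]
  have hmul {x y : ΩIdx G} :
      mulTY G χ τ (Pi.single ⟨(Sum.inl (0, a), Sum.inl (0, a)), rfl⟩ 1)
        (Pi.single ⟨(Sum.inl (0, x), Sum.inl (0, y)), rfl⟩ 1) =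
      if x = a ∧ y = a then tens (basisV (Sum.inl (0, a))) (basisV (Sum.inl (0, a))) else 0 := by
    rw [single_eq_tens, single_eq_tens, mulTY_tens χ τ (isHomog_basisV_inl 0 a)
      (isHomog_basisV_inl 0 a) (isHomog_basisV_inl 0 x) (isHomog_basisV_inl 0 y),
      circ_basisV_zero, circ_basisV_zero]
    by_cases hx : x = a <;> by_cases hy : y = a <;> simp [hx, hy, tens_zero_left]
    ext; simp [tens]
  rw [εsTY_eq_sum, Finset.sum_eq_single ⟨(Sum.inl (0, a), Sum.inl (0, a)), rfl⟩]
  · have hgr : gradeProj (tyGrade G (Sum.inl (0, a))) (vΩ : TYV G) = vΩ :=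
      isHomog_vΩ.gradeProj_eq
    rw [hmul, if_pos ⟨rfl, rfl⟩, εTY_tens, hcol, hvΩ, hgr,
      Finset.sum_eq_single (Sum.inl (0, a))]
    · simp [basisV_apply]
    · intro c _ hc
      simp [basisV_apply, hc]
    · simp
  · rintro ⟨⟨r1, r2⟩, hr⟩ _ hne
    simp only
    rcases r1 with ⟨h, x⟩ | r1
    · rcases r2 with ⟨h', y⟩ | r2
      · simp only [tyGrade, Sum.inl.injEq] at hr
        subst hr
        by_cases hh : h = 0
        · subst hh
          rw [hmul, if_neg]
          · simp [εTY]
          · rintro ⟨rfl, rfl⟩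
            exact hne rfl
        · rw [hcol, hvΩ' hh]
          simp [tens_zero_left]
      · simp [tyGrade] at hr
    · rcases r2 with ⟨h', y⟩ | r2
      · simp [tyGrade] at hr
      · have : (vΩ : TYV G) (Sum.inr r2) = 0 := rfl
        rw [hcol, this]
        simp [tens_zero_left]
  · simp

lemma BsTY_eq (χ : G → G → ℂ) (τ : ℝ) :
    BsTY G χ τ = colSub (Submodule.span ℂ {vΩ}) := by
  refine le_antisymm (Submodule.span_le.2 ?_) fun b hb => ?_
  · rintro _ ⟨b, rfl⟩
    rw [SetLike.mem_coe, εsTY_eq_sum]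
    refine sum_mem fun r _ => Submodule.smul_mem _ _ ?_
    exact tens_mem_colSub (fun _ _ => gradeProj_mem_spanVΩ _)
      (mem_colSub.1 (isCoidealTY_colSub_spanVΩ χ τ).1 _) _
  · refine colSub_induction (P := fun b => b ∈ BsTY G χ τ) spanVΩ_le_range (zero_mem _)
      (fun _ _ => add_mem) ?_ hb
    intro g a u hu _
    obtain ⟨c, rfl⟩ := Submodule.mem_span_singleton.1 hu
    rw [tens_smul_left]
    refine Submodule.smul_mem _ _ ?_
    by_cases hg : g = 0
    · subst hg
      rw [← εsTY_single χ τ a]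
      exact Submodule.subset_span ⟨_, rfl⟩
    · rw [tens_eq_zero (x := Sum.inl 0) (y := Sum.inl g) (by simpa using Ne.symm hg)
        isHomog_vΩ (isHomog_basisV_inl g a)]
      exact zero_mem _

lemma colSub_le_iff {W W' : Submodule ℂ (TYV G)} (hW : ∀ x, ∀ u ∈ W, gradeProj x u ∈ W) :
    colSub W ≤ colSub W' ↔ W ≤ W' := by
  refine ⟨fun h u hu => ?_, colSub_mono⟩
  rw [sum_gradeProj u]
  refine sum_mem fun x _ => ?_
  obtain ⟨β, rfl⟩ : ∃ β, tyGrade G β = x := by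
    rcases x with g | x
    · exact ⟨Sum.inl (g, Sum.inr ()), rfl⟩
    · exact ⟨Sum.inr (Sum.inl 0), rfl⟩
  have h2 := mem_colSub.1 (h (tens_mem_colSub hW hu (basisV β))) β
  rwa [colB_tens, basisV_apply, if_pos rfl, star_one, one_smul] at h2

lemma latV_le_iff {χ : G → G → ℂ} (hχ : IsNondegBichar χ) {L K : AddSubgroup G} :
    latV L (hχ.perp L) ≤ latV K (hχ.perp K) ↔ K ≤ L := by
  constructor
  · intro h k hk
    have hL : embV (fun x => if x ∈ L then 1 else 0, 0) ∈ latV L (hχ.perp L) :=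
      embV_mem_latV.2 ⟨fun k l hl => by simp [L.add_mem_cancel_right hl], by simp⟩
    have := (embV_mem_latV.1 (h hL)).1 0 k hk
    by_contra hkL
    simp [hkL] at this
  · intro h u hu
    obtain ⟨f, rfl, h1, h2⟩ := exists_of_mem_latV hu
    exact embV_mem_latV.2 ⟨fun k l hl => h1 k l (h hl),
      fun g hg => h2 g fun hgL => hg (hχ.perp_anti h hgL)⟩

lemma not_latV_le_spanVΩ (L M : AddSubgroup G) : ¬ latV L M ≤ Submodule.span ℂ {(vΩ : TYV G)} := by
  intro h
  have h0 : basisV (Sum.inl (0, Sum.inr ())) ∈ latV L M := by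
    rw [basisV_eq_embV]
    refine embV_mem_latV.2 ⟨fun _ _ _ => rfl, fun g hg => ?_⟩
    have : g ≠ 0 := by
      rintro rfl
      exact hg M.zero_mem
    simp [this]
  obtain ⟨c, hc⟩ := Submodule.mem_span_singleton.1 (h h0)
  have h1 := congrFun hc (Sum.inl (0, Sum.inl 0))
  have h2 := congrFun hc (Sum.inl (0, Sum.inr ()))
  simp [vΩ, embV_apply, basisV_apply] at h1 h2
  simp [h1] at h2

lemma extLe_iff {χ : G → G → ℂ} (hχ : IsNondegBichar χ) (τ : ℝ) (x y : AddSubgroup G ⊕ Unit) :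
    extLe G x y ↔ ILext G χ τ y ≤ ILext G χ τ x := by
  rcases x with L | x <;> rcases y with K | y <;> simp only [extLe, ILext]
  · rw [ILTY_eq hχ, ILTY_eq hχ, colSub_le_iff (fun _ _ => gradeProj_mem_latV _), latV_le_iff]
  · rw [ILTY_eq hχ, BsTY_eq, colSub_le_iff (fun _ _ => gradeProj_mem_spanVΩ _),
      Submodule.span_singleton_le_iff_mem]
    exact iff_of_true trivial (vΩ_mem_latV _ _)
  · rw [ILTY_eq hχ, BsTY_eq, colSub_le_iff (fun _ _ => gradeProj_mem_latV _)]
    exact iff_of_false not_false (not_latV_le_spanVΩ _ _)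
  · exact iff_of_true trivial le_rfl

lemma ILTY_sup {χ : G → G → ℂ} (hχ : IsNondegBichar χ) (L K : AddSubgroup G) :
    ILTY G χ (L ⊔ K) = ILTY G χ L ⊓ ILTY G χ K := by
  rw [ILTY_eq hχ, ILTY_eq hχ, ILTY_eq hχ, ← colSub_inf]
  congr 1
  refine le_antisymm (le_inf ((latV_le_iff hχ).2 le_sup_left) ((latV_le_iff hχ).2 le_sup_right)) ?_
  rintro u ⟨hu, hu'⟩
  obtain ⟨f, rfl, h1, h2⟩ := exists_of_mem_latV hu
  obtain ⟨h1', h2'⟩ := embV_mem_latV.1 hu'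
  refine embV_mem_latV.2 ⟨fun k x hx => ?_, fun g hg => ?_⟩
  · obtain ⟨l, hl, l', hl', rfl⟩ := AddSubgroup.mem_sup.1 hx
    rw [← add_assoc, h1' _ _ hl', h1 _ _ hl]
  · rw [hχ.perp_sup] at hg
    by_cases hgL : g ∈ hχ.perp L
    · exact h2' g fun hgK => hg ⟨hgL, hgK⟩
    · exact h2 g hgL

lemma bCoset_mul (χ : G → G → ℂ) (τ : ℝ) (Y Z : Set G) (w : ΩIdx G) :
    mulTY G χ τ (bCoset G Y w) (bCoset G Z w) = bCoset G (Y ∩ Z) w := by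
  simp only [bCoset_eq]
  rw [mulTY_tens χ τ (isHomog_embV_zero _) (isHomog_basisV_inl 0 w) (isHomog_embV_zero _)
    (isHomog_basisV_inl 0 w), circ_basisV_zero, if_pos rfl, circ_embV]
  congr 2
  ext k
  · by_cases hk : k ∈ Y <;> by_cases hk' : k ∈ Z <;> simp [hk, hk']
  · simp

lemma bM_mul (χ : G → G → ℂ) (τ : ℝ) (l l' : G) (w : ΩIdx G) :
    mulTY G χ τ (bM G l (shiftΩ G w l')) (bM G l' w) = bM G (l + l') w := by
  simp only [bM_eq]
  rw [mulTY_tens χ τ (isHomog_basisV_inl l _) (isHomog_basisV_inl l _) (isHomog_basisV_inl l' _)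
    (isHomog_basisV_inl l' w), circ_inl_inr_inl, if_pos rfl]
  congr 1
  rcases w with w | w
  · simp [shiftΩ, circ_inl_inl_inl]
  · cases w
    simp [shiftΩ, circ_inl_inr_inl]

lemma ILTY_inf {χ : G → G → ℂ} (hχ : IsNondegBichar χ) (τ : ℝ) (L K : AddSubgroup G) :
    ILTY G χ (L ⊓ K) =
      starSubalgGen G χ τ ((ILTY G χ L : Set (TYB G)) ∪ (ILTY G χ K : Set (TYB G))) := by
  refine le_antisymm (le_sInf ?_) (sInf_le ?_)
  · rintro J ⟨hJ, -, hmul, -⟩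
    refine Submodule.span_le.2 ?_
    rintro b (⟨g, w, rfl⟩ | ⟨l, hl, w, rfl⟩)
    · rw [show {x : G | x - g ∈ L ⊓ K} = {x : G | x - g ∈ L} ∩ {x : G | x - g ∈ K} from rfl,
        ← bCoset_mul χ τ]
      exact hmul _ (hJ (Or.inl (Submodule.subset_span (Or.inl ⟨g, w, rfl⟩)))) _
        (hJ (Or.inr (Submodule.subset_span (Or.inl ⟨g, w, rfl⟩))))
    · have hl' : l ∈ hχ.perp L ⊔ hχ.perp K := by
        rw [← hχ.perp_inf]
        exact hl
      obtain ⟨l₁, hl₁, l₂, hl₂, rfl⟩ := AddSubgroup.mem_sup.1 hl'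
      rw [← bM_mul χ τ]
      exact hmul _ (hJ (Or.inl (Submodule.subset_span (Or.inr ⟨l₁, hl₁, _, rfl⟩)))) _
        (hJ (Or.inr (Submodule.subset_span (Or.inr ⟨l₂, hl₂, _, rfl⟩))))
  · have h := isCoidealTY_colSub_latV hχ τ (L ⊓ K)
    rw [← ILTY_eq hχ] at h
    refine ⟨Set.union_subset ?_ ?_, h.1, h.2.1, h.2.2.1⟩
    · exact (extLe_iff hχ τ (Sum.inl (L ⊓ K)) (Sum.inl L)).1 inf_le_left
    · exact (extLe_iff hχ τ (Sum.inl (L ⊓ K)) (Sum.inl K)).1 inf_le_right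

lemma isHomog_embV_single (g : G) (c : ℂ) : IsHomog (Sum.inl g) (embV (0, Pi.single g c)) := by
  intro a ha
  rcases a with ⟨h, x | x⟩ | x <;> simp_all [embV_apply, tyGrade]

lemma embV_single_mem {W : Submodule ℂ (TYV G)} (g : G) {c : ℂ} (hc : c ≠ 0) :
    embV (0, Pi.single g c) ∈ W ↔ embV (0, Pi.single g 1) ∈ W := by
  have h : embV (0, Pi.single g c) = c • embV (0, (Pi.single g 1 : G → ℂ)) := by
    rw [← map_smul]
    congr 1
    ext k
    · simp
    · by_cases hk : k = g <;> simp [hk]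
  rw [h, Submodule.smul_mem_iff _ hc]

/-- Classification of the subspaces `W` of `V` for which `colSub W` is an invariant coideal. -/
lemma eq_spanVΩ_or_eq_latV {χ : G → G → ℂ} (hχ : IsNondegBichar χ) {τ : ℝ} (hτ : τ ≠ 0)
    {W : Submodule ℂ (TYV G)} (hE : W ≤ LinearMap.range embV)
    (hg : ∀ x, ∀ u ∈ W, gradeProj x u ∈ W) (hΩ : vΩ ∈ W)
    (hc : ∀ g h u v, u ∈ W → v ∈ W → IsHomog (Sum.inl g) u → IsHomog (Sum.inl h) v →
      circ χ τ u v ∈ W)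
    (hs : ∀ g u, u ∈ W → IsHomog (Sum.inl g) u → stV u ∈ W)
    (ha : ∀ u ∈ W, adV χ τ (Sum.inr (Sum.inl 0)) u ∈ W) :
    W = Submodule.span ℂ {vΩ} ∨ ∃ L, W = latV L (hχ.perp L) := by
  have hτ' : (τ : ℂ) ≠ 0 := by exact_mod_cast hτ
  have hsnd {f : (G → ℂ) × (G → ℂ)} (hf : embV f ∈ W) {g : G} (hg0 : g ≠ 0) (hfg : f.2 g ≠ 0) :
      embV (0, Pi.single g 1) ∈ W := by
    have h := hg (Sum.inl g) _ hf
    rwa [gradeProj_embV_of_ne hg0, embV_single_mem g hfg] at h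
  have hfourier {φ : G → ℂ} (hφ : embV (φ, 0) ∈ W) {g : G} (hφg : ∑ k, φ k * (χ g k)⁻¹ ≠ 0) :
      embV (0, Pi.single g 1) ∈ W := by
    have h := ha _ hφ
    rw [adV_inr_inl_embV] at h
    have hne : (τ : ℂ) * ∑ k, φ k * (χ g k)⁻¹ ≠ 0 := mul_ne_zero hτ' hφg
    by_cases hg0 : g = 0
    · subst hg0
      have h2 := hg (Sum.inl 0) _ h
      rw [gradeProj_embV_zero] at h2
      rw [← embV_single_mem 0 hne]
      have h3 : (fun k => (τ : ℂ)⁻¹ * ∑ l, (0 : G → ℂ) l * χ l k) = 0 := by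
        ext
        simp
      simpa only [h3] using h2
    · exact hsnd h hg0 hne
  have hchar {l : G} (hl : embV (0, Pi.single l 1) ∈ W) : embV (χ l, 0) ∈ W := by
    have h := ha _ hl
    rw [adV_inr_inl_embV] at h
    have h2 : embV ((fun k => (τ : ℂ)⁻¹ * ∑ l', (Pi.single l 1 : G → ℂ) l' * χ l' k),
        (fun g => (τ : ℂ) * ∑ k, (0 : G → ℂ) k * (χ g k)⁻¹)) = (τ : ℂ)⁻¹ • embV (χ l, 0) := by
      rw [← map_smul]
      congr 1
      ext k
      · simp [Pi.single_apply]
      · simp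
    simp only [h2] at h
    exact (Submodule.smul_mem_iff _ (inv_ne_zero hτ')).1 h
  by_cases h0 : embV (0, Pi.single 0 1) ∈ W
  · right
    let M : AddSubgroup G :=
      { carrier := {g | embV (0, Pi.single g 1) ∈ W}
        zero_mem' := h0
        add_mem' := by
          intro g h hgM hhM
          have h1 := hc g h _ _ hgM hhM (isHomog_embV_single g 1) (isHomog_embV_single h 1)
          rwa [← basisV_eq_embV, ← basisV_eq_embV, circ_inl_inr_inl, if_pos rfl,
            basisV_eq_embV] at h1
        neg_mem' := by
          intro g hgM
          have h1 := hs g _ hgM (isHomog_embV_single g 1)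
          rw [stV_embV] at h1
          have h2 : ((fun k => star ((0 : G → ℂ) k)),
              fun h => star ((Pi.single g 1 : G → ℂ) (-h))) = ((0 : G → ℂ), Pi.single (-g) 1) := by
            ext k
            · simp
            · by_cases hk : k = -g
              · simp [hk]
              · have : -k ≠ g := fun h => hk (by rw [← h, neg_neg])
                simp [hk, this]
          simp only [h2] at h1
          exact h1 }
    have hM {g : G} : g ∈ M ↔ embV (0, Pi.single g 1) ∈ W := Iff.rfl
    refine ⟨hχ.perp M, le_antisymm (fun u hu => ?_) fun u hu => ?_⟩
    · obtain ⟨f, rfl⟩ := hE hu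
      rw [hχ.perp_perp]
      refine embV_mem_latV.2 ⟨fun x l hl => ?_, fun g hgM => ?_⟩
      · refine hχ.apply_add_of_fourier (fun g hgl => ?_) x
        by_contra hne
        refine hgl ?_
        rw [hχ.symm]
        refine hl g (hfourier ?_ hne)
        have h1 := hg (Sum.inl 0) _ hu
        rw [gradeProj_embV_zero] at h1
        have h2 : embV (f.1, 0) = embV (f.1, Pi.single 0 (f.2 0)) -
            f.2 0 • embV (0, (Pi.single 0 1 : G → ℂ)) := by
          rw [← map_smul, ← map_sub]
          congr 1
          ext k
          · simp
          · by_cases hk : k = 0 <;> simp [hk]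
        rw [h2]
        exact sub_mem h1 (Submodule.smul_mem _ _ h0)
      · by_contra hne
        have hg0 : g ≠ 0 := by
          rintro rfl
          exact hgM M.zero_mem
        exact hgM (hsnd hu hg0 hne)
    · rw [hχ.perp_perp] at hu
      obtain ⟨f, rfl, h1, h2⟩ := exists_of_mem_latV hu
      have hcard : (Fintype.card G : ℂ) ≠ 0 := by
        exact_mod_cast (Fintype.card_pos (α := G)).ne'
      have hf : embV f = (Fintype.card G : ℂ)⁻¹ •
          ∑ g, (∑ k, f.1 k * (χ g k)⁻¹) • embV (χ g, 0) +
          ∑ g, f.2 g • embV (0, (Pi.single g 1 : G → ℂ)) := by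
        simp only [← map_smul, ← map_sum, ← map_add]
        congr 1
        ext k
        · simp [Prod.fst_sum, Finset.sum_apply, hχ.fourier_inversion, hcard]
        · simp [Prod.snd_sum, Finset.sum_apply, Pi.single_apply]
      rw [hf]
      refine add_mem (Submodule.smul_mem _ _ (sum_mem fun g _ => ?_)) (sum_mem fun g _ => ?_)
      · by_cases hgM : g ∈ M
        · exact Submodule.smul_mem _ _ (hchar hgM)
        · rw [← hχ.perp_perp M] at hgM
          obtain ⟨l, hl, hgl⟩ := hχ.exists_of_notMem_perp hgM
          rw [hχ.sum_mul_inv_eq_zero (fun k => h1 k l hl) hgl, zero_smul]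
          exact zero_mem _
      · by_cases hgM : g ∈ M
        · exact Submodule.smul_mem _ _ hgM
        · rw [h2 g hgM, zero_smul]
          exact zero_mem _
  · left
    have hzero {φ : G → ℂ} (hφ : embV (φ, 0) ∈ W) : φ = 0 := by
      by_contra hne
      have h1 := hs 0 _ hφ (isHomog_embV_zero φ)
      have hφs : stV (embV (φ, 0)) = embV ((fun k => star (φ k)), 0) := by
        rw [stV_embV]
        congr 1
        ext k <;> simp
      rw [hφs] at h1
      have h2 := hc 0 0 _ _ hφ h1 (isHomog_embV_zero φ) (isHomog_embV_zero _)
      have hφc : circ χ τ (embV (φ, 0)) (embV ((fun k => star (φ k)), 0)) =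
          embV ((fun k => φ k * star (φ k)), 0) := by
        rw [circ_embV]
        congr 1
        ext k <;> simp
      rw [hφc] at h2
      refine h0 (hfourier h2 ?_)
      simp only [hχ.zero_left, inv_one, mul_one, Complex.star_def, Complex.mul_conj]
      rw [← Complex.ofReal_sum]
      norm_cast
      rw [Finset.sum_eq_zero_iff_of_nonneg fun k _ => Complex.normSq_nonneg _]
      intro hall
      exact hne (funext fun k => Complex.normSq_eq_zero.1 (hall k (Finset.mem_univ k)))
    refine le_antisymm (fun u hu => ?_) ((Submodule.span_singleton_le_iff_mem _ _).2 hΩ)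
    obtain ⟨f, rfl⟩ := hE hu
    have hf2 (g : G) (hg0 : g ≠ 0) : f.2 g = 0 := by
      by_contra hne
      have h := congrFun (hzero (hchar (hsnd hu hg0 hne))) 0
      exact hχ.ne_zero g 0 h
    have h1 := hg (Sum.inl 0) _ hu
    rw [gradeProj_embV_zero] at h1
    have h2 : embV ((fun k => f.1 k - f.2 0), 0) =
        embV (f.1, Pi.single 0 (f.2 0)) - f.2 0 • (vΩ : TYV G) := by
      rw [vΩ, ← map_smul, ← map_sub]
      congr 1
      ext k
      · simp
      · by_cases hk : k = 0 <;> simp [hk]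
    have h3 : embV ((fun k => f.1 k - f.2 0), 0) ∈ W := by
      rw [h2]
      exact sub_mem h1 (Submodule.smul_mem _ _ hΩ)
    have h4 := hzero h3
    refine Submodule.mem_span_singleton.2 ⟨f.2 0, ?_⟩
    rw [vΩ, ← map_smul]
    congr 1
    ext k
    · have := congrFun h4 k
      simp only [Pi.zero_apply, sub_eq_zero] at this
      simp [this]
    · by_cases hk : k = 0
      · simp [hk]
      · simp [hk, hf2 k hk]

lemma basisV_self (β : VIdx G) : (basisV β : TYV G) β = 1 := by
  rw [basisV_apply, if_pos rfl]

lemma tens_mem_of_forall {J : Submodule ℂ (TYB G)} {u : TYV G}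
    (hu : ∀ β, tens u (basisV β) ∈ J) (w : TYV G) : tens u w ∈ J := by
  rw [sum_basisV w, tens_sum_right]
  refine sum_mem fun β _ => ?_
  rw [tens_smul_right]
  exact Submodule.smul_mem _ _ (hu β)

lemma lidx_eq_ridx_of_isInvariantTY {χ : G → G → ℂ} {τ : ℝ} {J : Submodule ℂ (TYB G)}
    (hJ : IsInvariantTY G χ τ J) {b : TYB G} (hb : b ∈ J) (r : BIdx G)
    (hr : lidx r.1.1 ≠ ridx r.1.1) : b r = 0 := by
  have hle : J ≤ LinearMap.ker (LinearMap.proj (R := ℂ) (φ := fun _ : BIdx G => ℂ) r) := by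
    rw [IsInvariantTY] at hJ
    rw [← hJ, Submodule.span_le]
    rintro _ ⟨a, -, x, rfl⟩
    rw [SetLike.mem_coe, LinearMap.mem_ker, LinearMap.proj_apply]
    by_contra h
    exact hr (idx_of_adTY_ne_zero h)
  exact hle hb

lemma gradeProj_mem_of_tens_mem {W : Submodule ℂ (TYV G)} {u w : TYV G}
    (h : tens u w ∈ colSub W) {β : VIdx G} (hβ : w β ≠ 0) :
    gradeProj (tyGrade G β) u ∈ W := by
  have h1 := mem_colSub.1 h β
  rw [colB_tens] at h1
  exact (Submodule.smul_mem_iff _ (star_ne_zero.2 hβ)).1 h1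

lemma mem_of_tens_mem {W : Submodule ℂ (TYV G)} {g : G} {u w : TYV G}
    (hu : IsHomog (Sum.inl g) u) (h : tens u w ∈ colSub W) {x : ΩIdx G}
    (hx : w (Sum.inl (g, x)) ≠ 0) : u ∈ W := by
  rw [← hu.gradeProj_eq]
  exact gradeProj_mem_of_tens_mem h hx

lemma isHomog_stV {g : G} {u : TYV G} (hu : IsHomog (Sum.inl g) u) :
    IsHomog (Sum.inl (-g)) (stV u) := by
  rintro (⟨h, a⟩ | a) hc
  · have hne : tyGrade G (Sum.inl (-h, shiftΩ G a h)) ≠ Sum.inl g := by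
      intro h'
      apply hc
      simp only [tyGrade, Sum.inl.injEq] at h' ⊢
      rw [← h', neg_neg]
    simp [stV, hu _ hne]
  · rfl

/-- Every invariant coideal is some `I^x`. -/
lemma exists_eq_ILext {χ : G → G → ℂ} (hχ : IsNondegBichar χ) {τ : ℝ} (hτ : τ ≠ 0)
    {J : Submodule ℂ (TYB G)} (hJ : IsCoidealTY G χ τ J) (hI : IsInvariantTY G χ τ J) :
    ∃ x, J = ILext G χ τ x := by
  have hτ' : (τ : ℂ) ≠ 0 := by exact_mod_cast hτ
  let W : Submodule ℂ (TYV G) :=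
    { carrier := {u | ∀ β, tens u (basisV β) ∈ J}
      zero_mem' := fun β => by rw [tens_zero_left]; exact zero_mem _
      add_mem' := fun hu hv β => by rw [tens_add_left]; exact add_mem (hu β) (hv β)
      smul_mem' := fun c u hu β => by rw [tens_smul_left]; exact Submodule.smul_mem _ _ (hu β) }
  have hW (u : TYV G) : u ∈ W ↔ ∀ β, tens u (basisV β) ∈ J := Iff.rfl
  have hJW : J = colSub W := eq_colSub_of_isCoidealTY hJ hW
  clear_value W
  have hE : W ≤ LinearMap.range embV := fun u hu => by
    refine ⟨_, (eq_embV fun c hc => ?_).symm⟩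
    have h := lidx_eq_ridx_of_isInvariantTY hI ((hW u).1 hu c) ⟨(c, c), rfl⟩ hc
    simpa [tens, basisV_self] using h
  have hg (x : ΩIdx G) (u : TYV G) (hu : u ∈ W) : gradeProj x u ∈ W := by
    rw [hW]
    intro β
    by_cases hx : tyGrade G β = x
    · subst hx
      rw [tens_gradeProj u (isHomog_basisV β)]
      exact (hW u).1 hu β
    · rw [tens_eq_zero (Ne.symm hx) (isHomog_gradeProj x u) (isHomog_basisV β)]
      exact zero_mem _
  have hten {u : TYV G} (hu : u ∈ W) (w : TYV G) : tens u w ∈ J :=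
    tens_mem_of_forall ((hW u).1 hu) w
  have hΩ : vΩ ∈ W := by
    have h1 := hJ.1
    rw [oneTY_eq, hJW] at h1
    exact mem_of_tens_mem isHomog_vΩ h1 (x := Sum.inr ()) (by simp [vΩ, embV_apply])
  have hc (g h : G) (u v : TYV G) (hu : u ∈ W) (hv : v ∈ W) (hug : IsHomog (Sum.inl g) u)
      (hvh : IsHomog (Sum.inl h) v) : circ χ τ u v ∈ W := by
    have h1 := hJ.2.1 _ (hten hu (basisV (Sum.inl (g, Sum.inr ())))) _
      (hten hv (basisV (Sum.inl (h, Sum.inr ()))))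
    rw [mulTY_tens χ τ hug (isHomog_basisV_inl g _) hvh (isHomog_basisV_inl h _),
      circ_inl_inr_inl, if_pos rfl, hJW] at h1
    refine mem_of_tens_mem (g := g + h) (isHomog_circ_inl hug hvh) h1 (x := Sum.inr ()) ?_
    simp [basisV_self]
  have hs (g : G) (u : TYV G) (hu : u ∈ W) (hug : IsHomog (Sum.inl g) u) : stV u ∈ W := by
    have h1 := hJ.2.2.1 _ (hten hu (basisV (Sum.inl (g, Sum.inr ()))))
    rw [starTY_tens τ hug, hJW] at h1
    refine mem_of_tens_mem (isHomog_stV hug) h1 (x := Sum.inr ()) ?_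
    simp [stV, basisV_apply, shiftΩ]
  have ha (u : TYV G) (hu : u ∈ W) : adV χ τ (Sum.inr (Sum.inl 0)) u ∈ W := by
    have homog (g : G) (v : TYV G) (hv : v ∈ W) (hvg : IsHomog (Sum.inl g) v) :
        adV χ τ (Sum.inr (Sum.inl 0)) v ∈ W := by
      have h1 : adTY G χ τ (tens v (basisV (Sum.inl (g, Sum.inl g))))
          (Pi.single ⟨(Sum.inr (Sum.inl 0), Sum.inr (Sum.inl g)), rfl⟩ 1) ∈ J := by
        rw [IsInvariantTY] at hI
        rw [← hI]
        exact Submodule.subset_span ⟨_, hten hv _, _, rfl⟩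
      rw [adTY_tens χ τ hvg (isHomog_basisV_inl g _), hJW] at h1
      simp only [barV, Sum.swap_inl, circ_inr_inr_inl, add_zero, if_true,
        circ_inr_inr_inr_inl] at h1
      rw [sum_gradeProj (adV χ τ (Sum.inr (Sum.inl 0)) v)]
      refine sum_mem fun x _ => ?_
      rcases x with g' | x
      · refine gradeProj_mem_of_tens_mem h1 (β := Sum.inl (g', Sum.inr ())) ?_
        simp [embV_apply, hτ, hχ.ne_zero]
      · obtain ⟨f, rfl⟩ := hE hv
        rw [adV_inr_inl_embV]
        cases x
        rw [gradeProj_embV_inr]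
        exact zero_mem _
    rw [sum_gradeProj u, map_sum]
    refine sum_mem fun x _ => ?_
    rcases x with g | x
    · exact homog g _ (hg _ u hu) (isHomog_gradeProj _ u)
    · obtain ⟨f, rfl⟩ := hE hu
      cases x
      rw [gradeProj_embV_inr, map_zero]
      exact zero_mem _
  rcases eq_spanVΩ_or_eq_latV hχ hτ hE hg hΩ hc hs ha with rfl | ⟨L, rfl⟩
  · exact ⟨Sum.inr (), by rw [hJW, ILext, BsTY_eq]⟩
  · exact ⟨Sum.inl L, by rw [hJW, ILext, ILTY_eq hχ]⟩

end TYAux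

/-- `x ↦ I^x` is an anti-isomorphism from the extended lattice
`Subgrp(G) ⊔ {Ω}` onto the lattice of invariant coideals of the Tambara–Yamagami WHA;
in particular `I^{L+K} = I^L ∩ I^K` and `I^{L∩K}` is the `*`-subalgebra generated by
`I^L ∪ I^K`. -/
theorem TY_lattice_anti_isomorphism (G : Type) [AddCommGroup G] [Fintype G] [DecidableEq G]
    (χ : G → G → ℂ) (τ : ℝ)
    (hχsymm : ∀ g h : G, χ g h = χ h g)
    (hχadd : ∀ g g' h : G, χ (g + g') h = χ g h * χ g' h)
    (hχnorm : ∀ g h : G, ‖χ g h‖ = 1)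
    (hχnondeg : ∀ g : G, (∀ h : G, χ g h = 1) → g = 0)
    (hτ : τ = (Real.sqrt (Fintype.card G))⁻¹ ∨ τ = -(Real.sqrt (Fintype.card G))⁻¹) :
    -- each `I^x` is an invariant coideal
    (∀ x : AddSubgroup G ⊕ Unit,
      IsCoidealTY G χ τ (ILext G χ τ x) ∧ IsInvariantTY G χ τ (ILext G χ τ x)) ∧
    -- every invariant coideal is some `I^x`
    (∀ J : Submodule ℂ (TYB G), IsCoidealTY G χ τ J → IsInvariantTY G χ τ J →
      ∃ x : AddSubgroup G ⊕ Unit, J = ILext G χ τ x) ∧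
    -- the map is an order anti-isomorphism
    (∀ x y : AddSubgroup G ⊕ Unit, extLe G x y ↔ ILext G χ τ y ≤ ILext G χ τ x) ∧
    -- lattice operations: `I^{L+K} = I^L ∩ I^K` and
    -- `I^{L∩K}` is the `*`-subalgebra generated by `I^L ∪ I^K`
    (∀ L K : AddSubgroup G,
      ILTY G χ (L ⊔ K) = ILTY G χ L ⊓ ILTY G χ K ∧
      ILTY G χ (L ⊓ K) =
        starSubalgGen G χ τ ((ILTY G χ L : Set (TYB G)) ∪ (ILTY G χ K : Set (TYB G)))) := by
  have hχ : IsNondegBichar χ := ⟨hχsymm, hχadd, hχnorm, hχnondeg⟩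
  obtain ⟨hτ0, hτG⟩ := tau_facts hτ
  refine ⟨?_, fun J hJ hI => exists_eq_ILext hχ hτ0 hJ hI, extLe_iff hχ τ,
    fun L K => ⟨ILTY_sup hχ L K, ILTY_inf hχ τ L K⟩⟩
  rintro (L | x)
  · rw [ILext, ILTY_eq hχ]
    exact ⟨isCoidealTY_colSub_latV hχ τ L, isInvariantTY_colSub_latV hχ hτ0 L⟩
  · rw [ILext, BsTY_eq]
    exact ⟨isCoidealTY_colSub_spanVΩ χ τ, isInvariantTY_colSub_spanVΩ hχ hτ0 hτG⟩

end
end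

section
/- Let B be a weak Hopf *-algebra with invertible antipode S, and let h : B → ℂ be a linear functional satisfying the strong invariance property (h ⊗ id)((w* ⊗ 1)Δ(v)) = (h ⊗ S^{−1})(Δ(w*)(v ⊗ 1)) for all v, w ∈ B. Then for every right coideal I ⊆ B, equipped with the sesquilinear form ⟨v, w⟩ := h(w*v), the identity ⟨v₍₁₎, w⟩ v₍₂₎ = ⟨v, w₍₁₎⟩ S(w₍₂₎)* holds for all v, w ∈ I (this is the unitarity axiom making (I, Δ|_I) a right unitary B-comodule when h is the normalized Haar measure). -/
open scoped TensorProduct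
open TensorProduct

noncomputable section

/-- The conjugate-linear "star" operation on a tensor product of two star modules,
defined via a choice of bases so that `star (x ⊗ y) = star x ⊗ star y`. -/
def tensorStar (M N : Type) [AddCommGroup M] [Module ℂ M] [Module.Finite ℂ M]
    [Module.Free ℂ M] [StarAddMonoid M] [AddCommGroup N] [Module ℂ N] [Module.Finite ℂ N]
    [Module.Free ℂ N] [StarAddMonoid N] (t : M ⊗[ℂ] N) : M ⊗[ℂ] N :=
  let bM := Module.Free.chooseBasis ℂ M
  let bN := Module.Free.chooseBasis ℂ N
  ∑ p : Module.Free.ChooseBasisIndex ℂ M × Module.Free.ChooseBasisIndex ℂ N,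
    (starRingEnd ℂ) (((bM.tensorProduct bN).repr t) p) • (star (bM p.1) ⊗ₜ[ℂ] star (bN p.2))

/-- A weak Hopf `*`-algebra structure on a finite-dimensional `C*`-algebra `B`. -/
structure WHA (B : Type) [NormedRing B] [StarRing B] [CStarRing B] [NormedAlgebra ℂ B]
    [StarModule ℂ B] [FiniteDimensional ℂ B] where
  Δ : B →ₗ[ℂ] B ⊗[ℂ] B
  ε : B →ₗ[ℂ] ℂ
  S : B →ₗ[ℂ] B
  coassoc : ∀ b : B, (TensorProduct.assoc ℂ B B B) ((TensorProduct.map Δ LinearMap.id) (Δ b)) =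
    (TensorProduct.map LinearMap.id Δ) (Δ b)
  counit_left : ∀ b : B, (TensorProduct.lid ℂ B) ((TensorProduct.map ε LinearMap.id) (Δ b)) = b
  counit_right : ∀ b : B, (TensorProduct.rid ℂ B) ((TensorProduct.map LinearMap.id ε) (Δ b)) = b
  comul_mul : ∀ a b : B, Δ (a * b) = Δ a * Δ b
  weak_counit : ∀ b c d : B, (TensorProduct.lid ℂ ℂ)
      ((TensorProduct.map (ε ∘ₗ LinearMap.mulLeft ℂ b) (ε ∘ₗ LinearMap.mulRight ℂ d)) (Δ c)) =
    ε (b * c * d)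
  weak_comul_one : (TensorProduct.map Δ LinearMap.id) (Δ 1) =
    (Δ 1 ⊗ₜ[ℂ] (1 : B)) * ((TensorProduct.assoc ℂ B B B).symm ((1 : B) ⊗ₜ[ℂ] Δ 1))
  comul_star : ∀ b : B, Δ (star b) = tensorStar B B (Δ b)
  antipode_mul : ∀ a b : B, S (a * b) = S b * S a
  antipode_one : S 1 = 1
  antipode_comul : ∀ b : B, Δ (S b) =
    (TensorProduct.map S S) ((TensorProduct.comm ℂ B B) (Δ b))
  counit_antipode : ∀ b : B, ε (S b) = ε b
  antipode_left : ∀ b : B, LinearMap.mul' ℂ B ((TensorProduct.map LinearMap.id S) (Δ b)) =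
    (TensorProduct.lid ℂ B) ((TensorProduct.map ε LinearMap.id) (Δ 1 * (b ⊗ₜ[ℂ] (1 : B))))
  antipode_right : ∀ b : B, LinearMap.mul' ℂ B ((TensorProduct.map S LinearMap.id) (Δ b)) =
    (TensorProduct.rid ℂ B) ((TensorProduct.map LinearMap.id ε) (((1 : B) ⊗ₜ[ℂ] b) * Δ 1))

namespace WHA

variable {B : Type} [NormedRing B] [StarRing B] [CStarRing B] [NormedAlgebra ℂ B]
  [StarModule ℂ B] [FiniteDimensional ℂ B]

/-- The target counital map `ε_t(b) = (ε ⊗ id)(Δ(1)(b ⊗ 1))`. -/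
def εt (W : WHA B) (b : B) : B :=
  (TensorProduct.lid ℂ B) ((TensorProduct.map W.ε LinearMap.id) (W.Δ 1 * (b ⊗ₜ[ℂ] (1 : B))))

/-- The source counital map `ε_s(b) = (id ⊗ ε)((1 ⊗ b)Δ(1))`. -/
def εs (W : WHA B) (b : B) : B :=
  (TensorProduct.rid ℂ B) ((TensorProduct.map LinearMap.id W.ε) (((1 : B) ⊗ₜ[ℂ] b) * W.Δ 1))

/-- The target counital subalgebra `B_t = ε_t(B)`. -/
def Bt (W : WHA B) : Submodule ℂ B := Submodule.span ℂ (Set.range W.εt)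

/-- The source counital subalgebra `B_s = ε_s(B)`. -/
def Bs (W : WHA B) : Submodule ℂ B := Submodule.span ℂ (Set.range W.εs)

/-- The right adjoint action `b ◁ x = S(x₍₁₎) b x₍₂₎`. -/
def ad (W : WHA B) (b x : B) : B :=
  LinearMap.mul' ℂ B ((TensorProduct.map W.S (LinearMap.mulLeft ℂ b)) (W.Δ x))

/-- `I` is a (right) coideal of `B`: a unital `*`-subalgebra with `Δ(I) ⊆ I ⊗ B`. -/
def IsCoideal (W : WHA B) (I : Submodule ℂ B) : Prop :=
  (1 : B) ∈ I ∧ (∀ a ∈ I, ∀ b ∈ I, a * b ∈ I) ∧ (∀ a ∈ I, star a ∈ I) ∧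
    ∀ a ∈ I, W.Δ a ∈ Submodule.span ℂ {x : B ⊗[ℂ] B | ∃ u ∈ I, ∃ v : B, x = u ⊗ₜ[ℂ] v}

/-- A coideal is invariant if `span{ b ◁ x : b ∈ I, x ∈ B } = I`. -/
def IsInvariant (W : WHA B) (I : Submodule ℂ B) : Prop :=
  Submodule.span ℂ {y : B | ∃ b ∈ I, ∃ x : B, y = W.ad b x} = I

end WHA

/-- A morphism of weak Hopf `*`-algebras. -/
structure WHAHom {B C : Type} [NormedRing B] [StarRing B] [CStarRing B] [NormedAlgebra ℂ B]
    [StarModule ℂ B] [FiniteDimensional ℂ B] [NormedRing C] [StarRing C] [CStarRing C]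
    [NormedAlgebra ℂ C] [StarModule ℂ C] [FiniteDimensional ℂ C]
    (W : WHA B) (W' : WHA C) where
  π : B →⋆ₐ[ℂ] C
  comul_comp : ∀ b : B, W'.Δ (π b) = (TensorProduct.map π.toLinearMap π.toLinearMap) (W.Δ b)
  antipode_comp : ∀ b : B, W'.S (π b) = π (W.S b)
  counit_comp : ∀ b : B, W'.ε (π b) = W.ε b


/-- The linear functional `x ↦ conj (h (x* v))` (`h` a functional, `v` fixed). -/
def conjPair {B : Type} [NormedRing B] [StarRing B] [CStarRing B] [NormedAlgebra ℂ B]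
    [StarModule ℂ B] [FiniteDimensional ℂ B] (h : B →ₗ[ℂ] ℂ) (v : B) : B →ₗ[ℂ] ℂ where
  toFun x := (starRingEnd ℂ) (h (star x * v))
  map_add' x y := by simp [star_add, add_mul]
  map_smul' c x := by
    simp [star_smul, smul_mul_assoc, map_smul, smul_eq_mul, map_mul, mul_comm]

/-- The canonical star operation on a tensor product of `*`-algebras is antimultiplicative. -/
theorem TensorProduct.star_mul_of_starModule {M N : Type} [Ring M] [StarRing M] [Algebra ℂ M]
    [StarModule ℂ M] [Ring N] [StarRing N] [Algebra ℂ N] [StarModule ℂ N] (x y : M ⊗[ℂ] N) :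
    star (x * y) = star y * star x := by
  induction x with
  | zero => simp
  | add x₁ x₂ h₁ h₂ => simp [add_mul, mul_add, h₁, h₂]
  | tmul a b =>
    induction y with
    | zero => simp
    | add y₁ y₂ h₁ h₂ => simp only [mul_add, star_add, h₁, h₂, add_mul]
    | tmul c d => simp

theorem tensorStar_eq_star {M N : Type} [AddCommGroup M] [Module ℂ M] [Module.Finite ℂ M]
    [Module.Free ℂ M] [StarAddMonoid M] [StarModule ℂ M] [AddCommGroup N] [Module ℂ N]
    [Module.Finite ℂ N] [Module.Free ℂ N] [StarAddMonoid N] [StarModule ℂ N] (t : M ⊗[ℂ] N) :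
    tensorStar M N t = star t := by
  conv_rhs => rw [← ((Module.Free.chooseBasis ℂ M).tensorProduct
    (Module.Free.chooseBasis ℂ N)).sum_repr t]
  simp only [tensorStar, star_sum, star_smul, Module.Basis.tensorProduct_apply',
    TensorProduct.star_tmul, starRingEnd_apply]

theorem TensorProduct.star_assoc_symm {A : Type} [Ring A] [StarRing A] [Algebra ℂ A]
    [StarModule ℂ A]
    (a : A) (t : A ⊗[ℂ] A) :
    star ((TensorProduct.assoc ℂ A A A).symm (a ⊗ₜ[ℂ] t)) =
      (TensorProduct.assoc ℂ A A A).symm (star a ⊗ₜ[ℂ] star t) := by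
  induction t with
  | zero => simp
  | add x y hx hy => simp only [map_add, star_add, tmul_add, hx, hy]
  | tmul b c => simp

theorem LinearMap.mul_map_mul_tmul_one {A : Type} [Ring A] [Algebra ℂ A] {f : A →ₗ[ℂ] A}
    (hf : ∀ a b, f (a * b) = f b * f a) (b : A) (t : A ⊗[ℂ] A) :
    LinearMap.mul' ℂ A (map f LinearMap.id (t * (b ⊗ₜ[ℂ] 1))) =
      f b * LinearMap.mul' ℂ A (map f LinearMap.id t) := by
  induction t with
  | zero => simp
  | add x y hx hy => simp only [map_add, add_mul, mul_add, hx, hy]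
  | tmul x y => simp [hf, mul_assoc]

theorem LinearMap.mul_map_one_tmul_mul {A : Type} [Ring A] [Algebra ℂ A] {f : A →ₗ[ℂ] A}
    (hf : ∀ a b, f (a * b) = f b * f a) (b : A) (t : A ⊗[ℂ] A) :
    LinearMap.mul' ℂ A (map LinearMap.id f ((1 ⊗ₜ[ℂ] b) * t)) =
      LinearMap.mul' ℂ A (map LinearMap.id f t) * f b := by
  induction t with
  | zero => simp
  | add x y hx hy => simp only [map_add, add_mul, mul_add, hx, hy]
  | tmul x y => simp [hf, mul_assoc]

namespace WHA

variable {B : Type} [NormedRing B] [StarRing B] [CStarRing B] [NormedAlgebra ℂ B]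
  [StarModule ℂ B] [FiniteDimensional ℂ B] (W : WHA B)

theorem comul_star_eq (b : B) : W.Δ (star b) = star (W.Δ b) := by
  rw [W.comul_star, tensorStar_eq_star]

theorem star_map_comul (t : B ⊗[ℂ] B) :
    star (map W.Δ LinearMap.id t) = map W.Δ LinearMap.id (star t) := by
  induction t with
  | zero => simp
  | add x y hx hy => simp only [map_add, star_add, hx, hy]
  | tmul a b => simp [comul_star_eq]

theorem star_comul_one : star (W.Δ 1) = W.Δ 1 := by
  rw [← comul_star_eq, star_one]

/-- The opposite ordering of the axiom on `(Δ ⊗ id)Δ(1)`. -/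
theorem map_comul_comul_one : map W.Δ LinearMap.id (W.Δ 1) =
    (TensorProduct.assoc ℂ B B B).symm ((1 : B) ⊗ₜ[ℂ] W.Δ 1) * (W.Δ 1 ⊗ₜ[ℂ] (1 : B)) := by
  have := congrArg star W.weak_comul_one
  rwa [star_map_comul, star_mul_of_starModule, star_assoc_symm, star_tmul, star_comul_one,
    star_one] at this

theorem counit_star (b : B) : W.ε (star b) = star (W.ε b) := by
  let η : B →ₗ[ℂ] ℂ :=
    { toFun := fun x => star (W.ε (star x))
      map_add' := by simp
      map_smul' := by simp [star_smul] }
  have hη (x : B) : η x = star (W.ε (star x)) := rfl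
  have h₁ (t : B ⊗[ℂ] B) : TensorProduct.rid ℂ B (map LinearMap.id η t) =
      star (TensorProduct.rid ℂ B (map LinearMap.id W.ε (star t))) := by
    induction t with
    | zero => simp
    | add x y hx hy => simp only [map_add, star_add, hx, hy]
    | tmul x y => simp [hη, star_smul]
  have h₂ (t : B ⊗[ℂ] B) : η (TensorProduct.lid ℂ B (map W.ε LinearMap.id t)) =
      W.ε (TensorProduct.rid ℂ B (map LinearMap.id η t)) := by
    induction t with
    | zero => simp
    | add x y hx hy => simp only [map_add, hx, hy]
    | tmul x y => simp [mul_comm]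
  have h₃ := h₂ (W.Δ b)
  rw [W.counit_left, h₁, ← comul_star_eq, W.counit_right, star_star, hη] at h₃
  rw [← h₃, star_star]

/-- The linear map `b ↦ b₍₁₎ f(b₍₂₎)`. -/
def idConv (f : B →ₗ[ℂ] B) : B →ₗ[ℂ] B := LinearMap.mul' ℂ B ∘ₗ map LinearMap.id f ∘ₗ W.Δ

/-- The linear map `b ↦ f(b₍₁₎) b₍₂₎`. -/
def convId (f : B →ₗ[ℂ] B) : B →ₗ[ℂ] B := LinearMap.mul' ℂ B ∘ₗ map f LinearMap.id ∘ₗ W.Δ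

theorem mul_map_convId (f g : B →ₗ[ℂ] B) (b : B) :
    LinearMap.mul' ℂ B (map (W.convId f) g (W.Δ b)) =
      LinearMap.mul' ℂ B (map f (W.idConv g) (W.Δ b)) := by
  have hl (t : B ⊗[ℂ] B) : LinearMap.mul' ℂ B (map (W.convId f) g t) =
      LinearMap.mul' ℂ B (map (LinearMap.mul' ℂ B ∘ₗ map f LinearMap.id) g
        (map W.Δ LinearMap.id t)) := by
    induction t with
    | zero => simp
    | add x y hx hy => simp only [map_add, hx, hy]
    | tmul a b => simp [convId]
  have hr (t : B ⊗[ℂ] B) : LinearMap.mul' ℂ B (map f (W.idConv g) t) =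
      LinearMap.mul' ℂ B (map f (LinearMap.mul' ℂ B ∘ₗ map LinearMap.id g)
        (map LinearMap.id W.Δ t)) := by
    induction t with
    | zero => simp
    | add x y hx hy => simp only [map_add, hx, hy]
    | tmul a b => simp [idConv]
  have ha (t : (B ⊗[ℂ] B) ⊗[ℂ] B) :
      LinearMap.mul' ℂ B (map (LinearMap.mul' ℂ B ∘ₗ map f LinearMap.id) g t) =
      LinearMap.mul' ℂ B (map f (LinearMap.mul' ℂ B ∘ₗ map LinearMap.id g)
        (TensorProduct.assoc ℂ B B B t)) := by
    induction t with
    | zero => simp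
    | add x y hx hy => simp only [map_add, hx, hy]
    | tmul a b =>
      induction a with
      | zero => simp
      | add x y hx hy => simp only [map_add, add_tmul, hx, hy]
      | tmul x y => simp [mul_assoc]
  rw [hl, hr, ha, W.coassoc]

theorem idConv_antipode (b : B) : W.idConv W.S b = W.εt b := W.antipode_left b

theorem convId_antipode (b : B) : W.convId W.S b = W.εs b := W.antipode_right b

theorem εt_one : W.εt 1 = 1 := by
  rw [εt, ← Algebra.TensorProduct.one_def, mul_one, W.counit_left]

theorem εs_one : W.εs 1 = 1 := by
  rw [εs, ← Algebra.TensorProduct.one_def, one_mul, W.counit_right]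

/-- `b₍₁₎ ⊗ ε_t(b₍₂₎) = Δ(1)(b ⊗ 1)`. -/
theorem map_id_idConv_antipode_comul (b : B) :
    map LinearMap.id (W.idConv W.S) (W.Δ b) = W.Δ 1 * (b ⊗ₜ[ℂ] 1) := by
  let Φ : (B ⊗[ℂ] B) ⊗[ℂ] B →ₗ[ℂ] B ⊗[ℂ] B :=
    map ((TensorProduct.rid ℂ B).toLinearMap ∘ₗ map LinearMap.id W.ε) LinearMap.id
  have h₁ (t : B ⊗[ℂ] B) :
      Φ (map W.Δ LinearMap.id t * (W.Δ b ⊗ₜ[ℂ] 1)) = t * (b ⊗ₜ[ℂ] 1) := by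
    induction t with
    | zero => simp
    | add x y hx hy => simp only [map_add, add_mul, hx, hy]
    | tmul x y => simp [Φ, ← W.comul_mul, W.counit_right]
  have h₂ (x y : B) (t : B ⊗[ℂ] B) :
      Φ ((TensorProduct.assoc ℂ B B B).symm (1 ⊗ₜ[ℂ] t) * ((x ⊗ₜ[ℂ] y) ⊗ₜ[ℂ] 1)) =
        x ⊗ₜ[ℂ] TensorProduct.lid ℂ B (map W.ε LinearMap.id (t * (y ⊗ₜ[ℂ] 1))) := by
    induction t with
    | zero => simp
    | add x y hx hy => simp only [map_add, add_mul, tmul_add, hx, hy]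
    | tmul p q => simp [Φ, smul_tmul]
  have h₃ (t : B ⊗[ℂ] B) :
      Φ ((TensorProduct.assoc ℂ B B B).symm (1 ⊗ₜ[ℂ] W.Δ 1) * (t ⊗ₜ[ℂ] 1)) =
        map LinearMap.id (W.idConv W.S) t := by
    induction t with
    | zero => simp
    | add x y hx hy => simp only [map_add, mul_add, add_tmul, hx, hy]
    | tmul x y => rw [h₂, map_tmul, idConv_antipode]; rfl
  rw [← h₁, map_comul_comul_one, mul_assoc, Algebra.TensorProduct.tmul_mul_tmul, ← W.comul_mul,
    one_mul, one_mul, h₃]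

/-- `ε_s(b₍₁₎) ⊗ b₍₂₎ = (1 ⊗ b)Δ(1)`. -/
theorem map_convId_antipode_id_comul (b : B) :
    map (W.convId W.S) LinearMap.id (W.Δ b) = (1 ⊗ₜ[ℂ] b) * W.Δ 1 := by
  let Φ : (B ⊗[ℂ] B) ⊗[ℂ] B →ₗ[ℂ] B ⊗[ℂ] B :=
    map ((TensorProduct.rid ℂ B).toLinearMap ∘ₗ map LinearMap.id W.ε) LinearMap.id
  have h₀ (x : B) (t : B ⊗[ℂ] B) : Φ ((TensorProduct.assoc ℂ B B B).symm (x ⊗ₜ[ℂ] t)) =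
      x ⊗ₜ[ℂ] TensorProduct.lid ℂ B (map W.ε LinearMap.id t) := by
    induction t with
    | zero => simp
    | add x y hx hy => simp only [map_add, tmul_add, hx, hy]
    | tmul p q => simp [Φ, smul_tmul]
  have hm (x : B) (s t : B ⊗[ℂ] B) : (TensorProduct.assoc ℂ B B B).symm (1 ⊗ₜ[ℂ] s) *
      (TensorProduct.assoc ℂ B B B).symm (x ⊗ₜ[ℂ] t) =
      (TensorProduct.assoc ℂ B B B).symm (x ⊗ₜ[ℂ] (s * t)) := by
    induction s with
    | zero => simp
    | add x y hx hy => simp only [map_add, tmul_add, add_mul, hx, hy]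
    | tmul p q =>
      induction t with
      | zero => simp
      | add x y hx hy => simp only [map_add, tmul_add, mul_add, hx, hy]
      | tmul x y => simp
  have h₁ (t : B ⊗[ℂ] B) : Φ ((TensorProduct.assoc ℂ B B B).symm (1 ⊗ₜ[ℂ] W.Δ b) *
      (TensorProduct.assoc ℂ B B B).symm (map LinearMap.id W.Δ t)) = (1 ⊗ₜ[ℂ] b) * t := by
    induction t with
    | zero => simp
    | add x y hx hy => simp only [map_add, mul_add, hx, hy]
    | tmul x y => simp [hm, h₀, ← W.comul_mul, W.counit_left]
  have h₂ (x y : B) (t : B ⊗[ℂ] B) :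
      Φ ((TensorProduct.assoc ℂ B B B).symm (1 ⊗ₜ[ℂ] (x ⊗ₜ[ℂ] y)) * (t ⊗ₜ[ℂ] 1)) =
        TensorProduct.rid ℂ B (map LinearMap.id W.ε ((1 ⊗ₜ[ℂ] x) * t)) ⊗ₜ[ℂ] y := by
    induction t with
    | zero => simp
    | add x y hx hy => simp only [map_add, mul_add, add_tmul, hx, hy]
    | tmul p q => simp [Φ]
  have h₃ (t : B ⊗[ℂ] B) :
      Φ ((TensorProduct.assoc ℂ B B B).symm (1 ⊗ₜ[ℂ] t) * (W.Δ 1 ⊗ₜ[ℂ] 1)) =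
        map (W.convId W.S) LinearMap.id t := by
    induction t with
    | zero => simp
    | add x y hx hy => simp only [map_add, add_mul, tmul_add, hx, hy]
    | tmul x y => rw [h₂, map_tmul, convId_antipode]; rfl
  rw [← h₁, ← W.coassoc, LinearEquiv.symm_apply_apply, map_comul_comul_one, ← mul_assoc, hm,
    ← W.comul_mul, mul_one, h₃]

/-- An antimultiplicative right convolution inverse of the identity equals the antipode. -/
theorem eq_antipode_of_idConv_eq {T : B →ₗ[ℂ] B} (hT : ∀ a b, T (a * b) = T b * T a)
    (h : W.idConv T = W.idConv W.S) : T = W.S := by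
  ext b
  have hl : LinearMap.mul' ℂ B (map (W.convId W.S) T (W.Δ b)) = T b := by
    have : map (W.convId W.S) T (W.Δ b) =
        map LinearMap.id T (map (W.convId W.S) LinearMap.id (W.Δ b)) := by
      rw [map_map, LinearMap.id_comp, LinearMap.comp_id]
    rw [this, map_convId_antipode_id_comul, LinearMap.mul_map_one_tmul_mul hT]
    have h1 : W.idConv T 1 = 1 := by rw [h, idConv_antipode, εt_one]
    exact (congrArg (· * T b) h1).trans (one_mul _)
  have hr : LinearMap.mul' ℂ B (map W.S (W.idConv W.S) (W.Δ b)) = W.S b := by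
    have : map W.S (W.idConv W.S) (W.Δ b) =
        map W.S LinearMap.id (map LinearMap.id (W.idConv W.S) (W.Δ b)) := by
      rw [map_map, LinearMap.id_comp, LinearMap.comp_id]
    rw [this, map_id_idConv_antipode_comul, LinearMap.mul_map_mul_tmul_one W.antipode_mul]
    have h1 : W.convId W.S 1 = 1 := by rw [convId_antipode, εs_one]
    exact (congrArg (W.S b * ·) h1).trans (mul_one _)
  rw [← hl, mul_map_convId, h, hr]

/-- The map `c ↦ ε(c 1₍₁₎) 1₍₂₎`. -/
def εtOp (c : B) : B :=
  TensorProduct.lid ℂ B (map (W.ε ∘ₗ LinearMap.mulLeft ℂ c) LinearMap.id (W.Δ 1))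

theorem comul_εtOp (c : B) : W.Δ (W.εtOp c) = W.Δ 1 * (W.εtOp c ⊗ₜ[ℂ] 1) := by
  set f := W.ε ∘ₗ LinearMap.mulLeft ℂ c with hf
  let Ψ : B ⊗[ℂ] (B ⊗[ℂ] B) →ₗ[ℂ] B ⊗[ℂ] B :=
    (TensorProduct.lid ℂ (B ⊗[ℂ] B)).toLinearMap ∘ₗ map f LinearMap.id
  have h₁ (t : B ⊗[ℂ] B) : W.Δ (TensorProduct.lid ℂ B (map f LinearMap.id t)) =
      Ψ (map LinearMap.id W.Δ t) := by
    induction t with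
    | zero => simp
    | add x y hx hy => simp only [map_add, hx, hy]
    | tmul x y => simp [Ψ]
  have h₂ (s t : B ⊗[ℂ] B) : Ψ (TensorProduct.assoc ℂ B B B
      ((TensorProduct.assoc ℂ B B B).symm (1 ⊗ₜ[ℂ] s) * (t ⊗ₜ[ℂ] 1))) =
        s * (TensorProduct.lid ℂ B (map f LinearMap.id t) ⊗ₜ[ℂ] 1) := by
    induction s with
    | zero => simp
    | add x y hx hy => simp only [map_add, tmul_add, add_mul, hx, hy]
    | tmul p q =>
      induction t with
      | zero => simp
      | add x y hx hy => simp only [map_add, add_tmul, mul_add, hx, hy]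
      | tmul x y => simp [Ψ, smul_tmul']
  rw [εtOp, h₁, ← W.coassoc, map_comul_comul_one, h₂]

theorem counit_εtOp_mul (c y : B) : W.ε (W.εtOp c * y) = W.ε (c * y) := by
  have h₁ (t : B ⊗[ℂ] B) :
      W.ε (TensorProduct.lid ℂ B (map (W.ε ∘ₗ LinearMap.mulLeft ℂ c) LinearMap.id t) * y) =
        TensorProduct.lid ℂ ℂ
          (map (W.ε ∘ₗ LinearMap.mulLeft ℂ c) (W.ε ∘ₗ LinearMap.mulRight ℂ y) t) := by
    induction t with
    | zero => simp
    | add x z hx hz => simp only [map_add, add_mul, hx, hz]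
    | tmul x z => simp
  rw [εtOp, h₁, W.weak_counit, mul_one]

theorem εs_εtOp (c : B) : W.εs (W.εtOp c) = W.εs c := by
  have h₁ (t : B ⊗[ℂ] B) :
      TensorProduct.rid ℂ B (map LinearMap.id W.ε ((1 ⊗ₜ[ℂ] W.εtOp c) * t)) =
        TensorProduct.rid ℂ B (map LinearMap.id W.ε ((1 ⊗ₜ[ℂ] c) * t)) := by
    induction t with
    | zero => simp
    | add x y hx hy => simp only [map_add, mul_add, hx, hy]
    | tmul x y => simp [counit_εtOp_mul]
  exact h₁ _

theorem antipode_εtOp (c : B) : W.S (W.εtOp c) = W.εs c := by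
  have := W.convId_antipode (W.εtOp c)
  rw [convId, LinearMap.comp_apply, LinearMap.comp_apply, comul_εtOp,
    LinearMap.mul_map_mul_tmul_one W.antipode_mul, εs_εtOp] at this
  have h1 : W.convId W.S 1 = 1 := by rw [convId_antipode, εs_one]
  rw [← this]
  exact ((congrArg (W.S (W.εtOp c) * ·) h1).trans (mul_one _)).symm

theorem star_εt (b : B) : star (W.εt b) = W.εtOp (star b) := by
  have h₁ (t : B ⊗[ℂ] B) :
      star (TensorProduct.lid ℂ B (map W.ε LinearMap.id (t * (b ⊗ₜ[ℂ] 1)))) =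
        TensorProduct.lid ℂ B
          (map (W.ε ∘ₗ LinearMap.mulLeft ℂ (star b)) LinearMap.id (star t)) := by
    induction t with
    | zero => simp
    | add x y hx hy => simp only [map_add, add_mul, star_add, hx, hy]
    | tmul x y => simp [star_smul, ← star_mul, counit_star]
  rw [εt, h₁, star_comul_one, εtOp]

/-- The antipode satisfies `S⁻¹(b*) = S(b)*`. -/
theorem antipode_inv_star {Sinv : B →ₗ[ℂ] B} (hS1 : W.S ∘ₗ Sinv = LinearMap.id)
    (hS2 : Sinv ∘ₗ W.S = LinearMap.id) (b : B) : Sinv (star b) = star (W.S b) := by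
  have hr (x : B) : W.S (Sinv x) = x := LinearMap.congr_fun hS1 x
  have hl (x : B) : Sinv (W.S x) = x := LinearMap.congr_fun hS2 x
  have hmul (x y : B) : Sinv (x * y) = Sinv y * Sinv x := by
    rw [← hl (Sinv y * Sinv x), W.antipode_mul, hr, hr]
  let T : B →ₗ[ℂ] B :=
    { toFun := fun x => star (Sinv (star x))
      map_add' := by simp
      map_smul' := by simp [star_smul] }
  have hT (x : B) : T x = star (Sinv (star x)) := rfl
  have hconv (t : B ⊗[ℂ] B) : LinearMap.mul' ℂ B (map LinearMap.id T t) =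
      star (Sinv (LinearMap.mul' ℂ B (map W.S LinearMap.id (star t)))) := by
    induction t with
    | zero => simp
    | add x y hx hy => simp only [map_add, star_add, hx, hy]
    | tmul x y => simp [hT, hmul, hl]
  have hTS : T = W.S := by
    refine W.eq_antipode_of_idConv_eq (fun x y => by simp [hT, hmul]) (LinearMap.ext fun x => ?_)
    have h₁ : W.idConv T x = star (Sinv (W.convId W.S (star x))) := by
      simp only [idConv, convId, LinearMap.comp_apply, hconv, comul_star_eq]
    rw [h₁, convId_antipode, ← antipode_εtOp, hl, ← star_εt, star_star, idConv_antipode]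
  rw [← hTS, hT, star_star]

end WHA

/-- a right coideal of a WHA, with the sesquilinear form `⟨v,w⟩ = h(w* v)`
given by a strongly invariant functional `h`, satisfies the comodule unitarity identity
`⟨v₍₁₎, w⟩ v₍₂₎ = ⟨v, w₍₁₎⟩ S(w₍₂₎)*`. -/
theorem coideal_unitarity {B : Type} [NormedRing B] [StarRing B] [CStarRing B]
    [NormedAlgebra ℂ B] [StarModule ℂ B] [FiniteDimensional ℂ B] (W : WHA B)
    (Sinv : B →ₗ[ℂ] B) (hS1 : W.S ∘ₗ Sinv = LinearMap.id) (hS2 : Sinv ∘ₗ W.S = LinearMap.id)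
    (h : B →ₗ[ℂ] ℂ)
    -- strong invariance: `(h ⊗ id)((w* ⊗ 1)Δ(v)) = (h ⊗ S⁻¹)(Δ(w*)(v ⊗ 1))`
    (hinv : ∀ v w : B,
      (TensorProduct.lid ℂ B) ((TensorProduct.map h LinearMap.id)
        (((star w) ⊗ₜ[ℂ] (1 : B)) * W.Δ v)) =
      (TensorProduct.lid ℂ B) ((TensorProduct.map h Sinv)
        (W.Δ (star w) * (v ⊗ₜ[ℂ] (1 : B)))))
    (I : Submodule ℂ B) (hco : W.IsCoideal I) :
    ∀ v ∈ I, ∀ w ∈ I,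
      (TensorProduct.lid ℂ B)
        ((TensorProduct.map (h ∘ₗ LinearMap.mulLeft ℂ (star w)) LinearMap.id) (W.Δ v)) =
      star ((TensorProduct.lid ℂ B)
        ((TensorProduct.map (conjPair h v) W.S) (W.Δ w))) := by
  intro v _ w _
  have h₁ (t : B ⊗[ℂ] B) : map (h ∘ₗ LinearMap.mulLeft ℂ (star w)) LinearMap.id t =
      map h LinearMap.id ((star w ⊗ₜ[ℂ] (1 : B)) * t) := by
    induction t with
    | zero => simp
    | add x y hx hy => simp only [map_add, mul_add, hx, hy]
    | tmul x y => simp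
  have h₂ (t : B ⊗[ℂ] B) :
      TensorProduct.lid ℂ B (map h Sinv (star t * (v ⊗ₜ[ℂ] (1 : B)))) =
        star (TensorProduct.lid ℂ B (map (conjPair h v) W.S t)) := by
    induction t with
    | zero => simp
    | add x y hx hy => simp only [map_add, star_add, add_mul, hx, hy]
    | tmul x y => simp [conjPair, star_smul, W.antipode_inv_star hS1 hS2]
  rw [h₁, hinv, W.comul_star_eq, h₂]

end
end
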